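/- arXiv:2512.08652 — 12 statements merged into one kernel-verified Lean document; each statement's English description precedes it below -/
import Mathlib

section
/- For every t ≥ 1 and all vertices x < y of the log-path graph L_t, there exists a monotone path in L_t from x to y of length at most 2t. -/
/-- `LEdge x y` : `{x, y}` is an edge of the log-path graph, traversed upward,
i.e. there is `r` with `2^r ∣ x` and `y = x + 2^r`. -/
def LEdge (x y : ℕ) : Prop := ∃ r : ℕ, 2 ^ r ∣ x ∧ y = x + 2 ^ r

/-- A monotone path in the log-path graph `L_t` from `x` to `y`, recorded as its
(strictly increasing) list of vertices: consecutive vertices form edges of `L_t`,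
all vertices lie in `{0, …, 2^t}`, the first vertex is `x` and the last is `y`.
Its length (number of edges) is `l.length - 1`. -/
def IsMonoPath (t x y : ℕ) (l : List ℕ) : Prop :=
  l.Chain' LEdge ∧ (∀ v ∈ l, v ≤ 2 ^ t) ∧ l.head? = some x ∧ l.getLast? = some y

inductive LR : ℕ → ℕ → ℕ → Prop
  | refl (x : ℕ) : LR 0 x x
  | head {n x y z : ℕ} : LEdge x y → LR n y z → LR (n + 1) x z

theorem LR.le {n x z : ℕ} (h : LR n x z) : x ≤ z := by
  induction h with
  | refl x => exact le_rfl
  | head e _ ih => obtain ⟨r, _, rfl⟩ := e; omega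

theorem LR.tail {n x y z : ℕ} (h : LR n x y) (e : LEdge y z) : LR (n + 1) x z := by
  induction h with
  | refl x => exact LR.head e (LR.refl _)
  | head e' _ ih => exact LR.head e' (ih e)

theorem LR.double {n x y : ℕ} (h : LR n x y) : LR n (2 * x) (2 * y) := by
  induction h with
  | refl x => exact LR.refl _
  | head e _ ih =>
    obtain ⟨r, hr, rfl⟩ := e
    refine LR.head ⟨r + 1, ?_, ?_⟩ ih
    · rw [pow_succ, mul_comm]; exact Nat.mul_dvd_mul_left 2 hr
    · ring

theorem LR.toList {n x z : ℕ} (h : LR n x z) : ∃ l : List ℕ,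
    (x :: l).IsChain LEdge ∧ (∀ v ∈ x :: l, v ≤ z) ∧ (x :: l).getLast? = some z ∧
      l.length = n := by
  induction h with
  | refl x => exact ⟨[], by simp⟩
  | @head n x y z e h ih =>
    obtain ⟨l, h1, h2, h3, h4⟩ := ih
    refine ⟨y :: l, List.isChain_cons_cons.2 ⟨e, h1⟩, ?_, ?_, by simp [h4]⟩
    · intro v hv
      rcases List.mem_cons.1 hv with rfl | hv
      · exact (LR.head e h).le
      · exact h2 v hv
    · rw [List.getLast?_cons_cons]; exact h3

theorem ledge_one (x : ℕ) : LEdge x (x + 1) := ⟨0, by simp, by simp⟩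

theorem LR.main (t : ℕ) : ∀ x y : ℕ, x ≤ y → y ≤ 2 ^ (t + 1) → ∃ n ≤ 2 * (t + 1), LR n x y := by
  induction t with
  | zero =>
    intro x y hxy hy
    have : y = x ∨ y = x + 1 ∨ y = x + 1 + 1 := by omega
    rcases this with rfl | rfl | rfl
    · exact ⟨0, by omega, LR.refl _⟩
    · exact ⟨1, by omega, (LR.refl _).tail (ledge_one _)⟩
    · exact ⟨2, by omega, ((LR.refl _).tail (ledge_one _)).tail (ledge_one _)⟩
  | succ t ih =>
    intro x y hxy hy
    rcases hxy.eq_or_lt with rfl | hlt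
    · exact ⟨0, by omega, LR.refl _⟩
    obtain ⟨n, hn, h⟩ := ih ((x + 1) / 2) (y / 2) (by omega) (by rw [pow_succ] at hy; omega)
    have h := h.double
    obtain ⟨m, hm, h'⟩ : ∃ m ≤ n + 1, LR m (2 * ((x + 1) / 2)) y := by
      rcases Nat.even_or_odd' y with ⟨k, hk | hk⟩
      · refine ⟨n, by omega, ?_⟩
        have : 2 * (y / 2) = y := by omega
        rwa [this] at h
      · refine ⟨n + 1, le_rfl, h.tail ?_⟩
        have : y = 2 * (y / 2) + 1 := by omega
        have e := ledge_one (2 * (y / 2))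
        rwa [← this] at e
    rcases Nat.even_or_odd' x with ⟨k, hk | hk⟩
    · refine ⟨m, by omega, ?_⟩
      have : 2 * ((x + 1) / 2) = x := by omega
      rwa [this] at h'
    · refine ⟨m + 1, by omega, LR.head ?_ h'⟩
      have : 2 * ((x + 1) / 2) = x + 1 := by omega
      rw [this]; exact ledge_one x

/-- For every `t ≥ 1` and vertices `x < y` of `L_t`, there is a
monotone path in `L_t` from `x` to `y` of length at most `2t`. -/
theorem logpath_short_path (t x y : ℕ) (ht : 1 ≤ t) (hxy : x < y) (hy : y ≤ 2 ^ t) :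
    ∃ l : List ℕ, IsMonoPath t x y l ∧ l.length - 1 ≤ 2 * t := by
  obtain ⟨s, rfl⟩ : ∃ s, t = s + 1 := ⟨t - 1, by omega⟩
  obtain ⟨n, hn, h⟩ := LR.main s x y hxy.le hy
  obtain ⟨l, h1, h2, h3, h4⟩ := h.toList
  exact ⟨x :: l, ⟨h1, fun v hv => (h2 v hv).trans hy, rfl, h3⟩, by simp [h4]; omega⟩
end

section
/- For every t ∈ ℕ and all vertices x < y of the log-path graph L_t, there is a unique monotone path from x to y of minimal length: if two monotone paths from x to y both have length equal to the minimum length over all monotone paths from x to y, then they have the same vertex sequence. -/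
theorem lp_no_cross {x r a s : ℕ} (hr : 2 ^ r ∣ x) (hs : 2 ^ s ∣ a) (hxa : x < a)
    (hab : a < x + 2 ^ r) : a + 2 ^ s ≤ x + 2 ^ r := by
  rcases le_or_gt s r with h | h
  · have h1 : 2 ^ s ∣ 2 ^ r := pow_dvd_pow 2 h
    have h2 : 2 ^ s ∣ x + 2 ^ r := dvd_add (h1.trans hr) h1
    have h3 : 2 ^ s ∣ (x + 2 ^ r) - a := Nat.dvd_sub h2 hs
    have := Nat.le_of_dvd (by omega) h3
    omega
  · have h1 : 2 ^ r ∣ a := (pow_dvd_pow 2 h.le).trans hs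
    have h3 : 2 ^ r ∣ a - x := Nat.dvd_sub h1 hr
    have := Nat.le_of_dvd (by omega) h3
    omega

theorem lp_le_last {l : List ℕ} : ∀ {a y : ℕ}, (a :: l).IsChain LEdge →
    (a :: l).getLast? = some y → a ≤ y := by
  induction l with
  | nil => intro a y _ h; simp at h; omega
  | cons b m ih =>
    intro a y hc hl
    rw [List.isChain_cons_cons] at hc
    rw [List.getLast?_cons_cons] at hl
    have := ih hc.2 hl
    obtain ⟨r, _, h⟩ := hc.1
    omega

theorem lp_pass {x r y : ℕ} (hr : 2 ^ r ∣ x) (hy : x + 2 ^ r ≤ y) {l : List ℕ} :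
    ∀ {a : ℕ}, x < a → a ≤ x + 2 ^ r → (a :: l).IsChain LEdge →
    (a :: l).getLast? = some y → ∃ m, (x + 2 ^ r) :: m <:+ a :: l := by
  induction l with
  | nil =>
    intro a h1 h2 _ h
    simp at h
    exact ⟨[], by rw [show a = x + 2 ^ r by omega]⟩
  | cons b m ih =>
    intro a h1 h2 hc hl
    rcases h2.eq_or_lt with h2 | h2
    · exact ⟨b :: m, by rw [h2]⟩
    rw [List.isChain_cons_cons] at hc
    rw [List.getLast?_cons_cons] at hl
    obtain ⟨s, hs, hb⟩ := hc.1
    have hp : 0 < 2 ^ s := by positivity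
    have := lp_no_cross hr hs h1 h2
    obtain ⟨m', hm⟩ := ih (by omega) (by omega) hc.2 hl
    exact ⟨m', hm.trans (List.suffix_cons _ _)⟩

theorem lp_not_lt {t x y a b : ℕ} {m n : List ℕ} (h₁ : IsMonoPath t x y (x :: a :: m))
    (h₂ : IsMonoPath t x y (x :: b :: n))
    (hmin : ∀ l : List ℕ, IsMonoPath t x y l → (x :: a :: m).length ≤ l.length) : ¬ a < b := by
  intro hab
  obtain ⟨c1, v1, -, e1⟩ := h₁
  obtain ⟨c2, v2, -, e2⟩ := h₂
  replace c1 : (x :: a :: m).IsChain LEdge := c1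
  replace c2 : (x :: b :: n).IsChain LEdge := c2
  rw [List.isChain_cons_cons] at c1 c2
  rw [List.getLast?_cons_cons] at e1 e2
  have hby := lp_le_last c2.2 e2
  obtain ⟨r, hr, rfl⟩ := c2.1
  obtain ⟨s, hs, ha⟩ := c1.1
  have hp : 0 < 2 ^ s := by positivity
  obtain ⟨k, hk⟩ := lp_pass hr hby (by omega) hab.le c1.2 e1
  have hlen : k.length < m.length := by
    rcases List.suffix_cons_iff.1 hk with h | h
    · have := (List.cons.inj h).1
      omega
    · have := h.length_le
      simp at this
      omega
  have := hmin (x :: (x + 2 ^ r) :: k) ⟨?_, ?_, rfl, ?_⟩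
  · simp at this
    omega
  · show List.IsChain LEdge _
    rw [List.isChain_cons_cons]
    exact ⟨⟨r, hr, rfl⟩, c1.2.suffix hk⟩
  · intro v hv
    rcases List.mem_cons.1 hv with h | h
    · exact v1 v (by simp [h])
    · exact v1 v (List.mem_cons_of_mem _ (hk.subset h))
  · rw [List.getLast?_cons_cons, ← e1]
    obtain ⟨p, hp⟩ := hk
    rw [← hp, List.getLast?_append]
    simp [List.getLast?_cons]

theorem lp_tail {t x y a : ℕ} {m : List ℕ} (h₁ : IsMonoPath t x y (x :: a :: m))
    (hmin : ∀ l : List ℕ, IsMonoPath t x y l → (x :: a :: m).length ≤ l.length) :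
    IsMonoPath t a y (a :: m) ∧
      ∀ l : List ℕ, IsMonoPath t a y l → (a :: m).length ≤ l.length := by
  obtain ⟨c1, v1, -, e1⟩ := h₁
  replace c1 : (x :: a :: m).IsChain LEdge := c1
  rw [List.isChain_cons_cons] at c1
  rw [List.getLast?_cons_cons] at e1
  refine ⟨⟨c1.2, fun v hv => v1 v (List.mem_cons_of_mem _ hv), rfl, e1⟩, ?_⟩
  rintro l ⟨c, v, h, e⟩
  cases l with
  | nil => simp at h
  | cons a' l =>
    simp at h
    subst h
    have := hmin (x :: a' :: l) ⟨?_, ?_, rfl, ?_⟩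
    · simpa using this
    · show List.IsChain LEdge _
      rw [List.isChain_cons_cons]
      exact ⟨c1.1, c⟩
    · intro w hw
      rcases List.mem_cons.1 hw with h | h
      · exact v1 w (by simp [h])
      · exact v w h
    · rw [List.getLast?_cons_cons, e]

theorem lp_main (t y : ℕ) (l₁ : List ℕ) : ∀ (x : ℕ) (l₂ : List ℕ),
    IsMonoPath t x y l₁ → IsMonoPath t x y l₂ →
    (∀ l : List ℕ, IsMonoPath t x y l → l₁.length ≤ l.length) →
    (∀ l : List ℕ, IsMonoPath t x y l → l₂.length ≤ l.length) → l₁ = l₂ := by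
  induction l₁ with
  | nil => rintro x l₂ ⟨-, -, h, -⟩; simp at h
  | cons x' l₁ ih =>
    intro x l₂ h₁ h₂ m₁ m₂
    have hx : x' = x := by simpa using h₁.2.2.1
    subst hx
    have hlen := le_antisymm (m₁ _ h₂) (m₂ _ h₁)
    cases l₂ with
    | nil => simp at hlen
    | cons x'' l₂ =>
      have hx : x'' = x' := by simpa using h₂.2.2.1
      subst hx
      cases l₁ with
      | nil =>
        cases l₂ with
        | nil => rfl
        | cons b n => simp at hlen
      | cons a m =>
        cases l₂ with
        | nil => simp at hlen
        | cons b n =>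
          have hab : a = b := le_antisymm (not_lt.1 (lp_not_lt h₂ h₁ m₂))
            (not_lt.1 (lp_not_lt h₁ h₂ m₁))
          subst hab
          have t₁ := lp_tail h₁ m₁
          have t₂ := lp_tail h₂ m₂
          rw [ih a (a :: n) t₁.1 t₂.1 t₁.2 t₂.2]

/-- For all vertices `x < y` of the log-path graph `L_t`, the monotone
path from `x` to `y` of minimal length is unique: any two monotone paths from `x` to `y`
both achieving the minimum length have the same vertex sequence. -/
theorem logpath_unique_shortest_path (t x y : ℕ) (hxy : x < y) (hy : y ≤ 2 ^ t)
    (l₁ l₂ : List ℕ) (h₁ : IsMonoPath t x y l₁) (h₂ : IsMonoPath t x y l₂)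
    (hmin₁ : ∀ l : List ℕ, IsMonoPath t x y l → l₁.length ≤ l.length)
    (hmin₂ : ∀ l : List ℕ, IsMonoPath t x y l → l₂.length ≤ l.length) :
    l₁ = l₂ := by
  exact lp_main t y l₁ x l₂ h₁ h₂ hmin₁ hmin₂
end

section
/- Let t ∈ ℕ and let x < y be vertices of the log-path graph L_t. Let r₀ be the largest r ∈ ℕ such that 2^r divides x and x + 2^r ≤ y (for x = 0 take the largest r with 2^r ≤ y). Then every monotone path in L_t from x to y passes through the vertex x + 2^{r₀}. -/
theorem logpath_edge_step (x y r₀ a b : ℕ) (hdvd : 2 ^ r₀ ∣ x)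
    (hmax : ∀ r : ℕ, 2 ^ r ∣ x → x + 2 ^ r ≤ y → r ≤ r₀)
    (hxa : x ≤ a) (ham : a < x + 2 ^ r₀) (hab : LEdge a b) (hby : b ≤ y) :
    b ≤ x + 2 ^ r₀ := by
  obtain ⟨r, hr, rfl⟩ := hab
  have key : r ≤ r₀ := by
    by_contra hlt
    push Not at hlt
    have h1 : 2 ^ r₀ ∣ a := (pow_dvd_pow 2 hlt.le).trans hr
    have h2 : 2 ^ r₀ ∣ a - x := Nat.dvd_sub h1 hdvd
    have h3 : a - x = 0 := Nat.eq_zero_of_dvd_of_lt h2 (by omega)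
    have h4 : a = x := by omega
    subst h4
    exact absurd (hmax r hr hby) (by omega)
  have h1 : 2 ^ r ∣ x + 2 ^ r₀ :=
    dvd_add ((pow_dvd_pow 2 key).trans hdvd) (pow_dvd_pow 2 key)
  have h2 : 2 ^ r ∣ (x + 2 ^ r₀) - a := Nat.dvd_sub h1 hr
  have h3 := Nat.le_of_dvd (by omega) h2
  omega

theorem logpath_aux (x y r₀ : ℕ) (hdvd : 2 ^ r₀ ∣ x) (hle : x + 2 ^ r₀ ≤ y)
    (hmax : ∀ r : ℕ, 2 ^ r ∣ x → x + 2 ^ r ≤ y → r ≤ r₀) (l : List ℕ) :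
    ∀ a : ℕ, List.IsChain LEdge (a :: l) → (a :: l).getLast? = some y →
      a ≤ y ∧ (x ≤ a → a ≤ x + 2 ^ r₀ → x + 2 ^ r₀ ∈ a :: l) := by
  induction l with
  | nil =>
    intro a _ h
    have h : a = y := by simpa using h
    refine ⟨h.le, fun _ h2 => ?_⟩
    have : x + 2 ^ r₀ = a := by omega
    simp [this]
  | cons b l ih =>
    intro a hc h
    rw [List.isChain_cons_cons] at hc
    rw [List.getLast?_cons_cons] at h
    obtain ⟨hb, hm⟩ := ih b hc.2 h
    have hab : a ≤ b := by
      obtain ⟨r, _, rfl⟩ := hc.1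
      omega
    refine ⟨hab.trans hb, fun h1 h2 => ?_⟩
    rcases h2.eq_or_lt with h3 | h3
    · rw [← h3]
      exact List.mem_cons_self
    · exact List.mem_cons_of_mem _
        (hm (h1.trans hab) (logpath_edge_step x y r₀ a b hdvd hmax h1 h3 hc.1 hb))

theorem logpath_greedy_vertex_forced (t x y r₀ : ℕ) (hxy : x < y) (hy : y ≤ 2 ^ t)
    (hdvd : 2 ^ r₀ ∣ x) (hle : x + 2 ^ r₀ ≤ y)
    (hmax : ∀ r : ℕ, 2 ^ r ∣ x → x + 2 ^ r ≤ y → r ≤ r₀)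
    (l : List ℕ) (hl : IsMonoPath t x y l) :
    x + 2 ^ r₀ ∈ l := by
  obtain ⟨hc, _, hh, hlast⟩ := hl
  cases l with
  | nil => simp at hh
  | cons a l =>
    have h : a = x := by simpa using hh
    subst h
    exact (logpath_aux a y r₀ hdvd hle hmax l a hc hlast).2 le_rfl (by omega)
end

section
/- For every t ≥ 2, the minimal length of a monotone path in the log-path graph L_t from the vertex 1 to the vertex 2^t − 1 is exactly 2(t − 1). -/
lemma lp_cons {t x y z n : ℕ} (h : LEdge x y) (hx : x ≤ 2 ^ t)
    (H : ∃ l : List ℕ, IsMonoPath t y z l ∧ l.length = n + 1) :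
    ∃ l : List ℕ, IsMonoPath t x z l ∧ l.length = n + 1 + 1 := by
  obtain ⟨l, ⟨h1, h2, h3, h4⟩, h5⟩ := H
  cases l with
  | nil => simp at h5
  | cons a l =>
    simp only [List.head?_cons, Option.some.injEq] at h3
    subst h3
    refine ⟨x :: a :: l, ⟨List.isChain_cons_cons.2 ⟨h, h1⟩, ?_, rfl, ?_⟩, by simpa using h5⟩
    · intro v hv
      rcases List.mem_cons.1 hv with rfl | hv
      · exact hx
      · exact h2 v hv
    · rw [List.getLast?_cons_cons]; exact h4

lemma lp_down (t k : ℕ) (hk : k + 1 ≤ t) :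
    ∃ l : List ℕ, IsMonoPath t (2 ^ t - 2 ^ k) (2 ^ t - 1) l ∧ l.length = k + 1 := by
  induction k with
  | zero => exact ⟨[2 ^ t - 1], ⟨by exact List.isChain_singleton _, by simp, by simp, by simp⟩, rfl⟩
  | succ k ih =>
    refine lp_cons (y := 2 ^ t - 2 ^ k) ⟨k, ?_, ?_⟩ (Nat.sub_le _ _) (ih (by omega))
    · exact Nat.dvd_sub (pow_dvd_pow 2 (by omega)) (pow_dvd_pow 2 (by omega))
    · have : 2 ^ (k + 1) ≤ 2 ^ t := Nat.pow_le_pow_right (by norm_num) (by omega)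
      rw [pow_succ] at *
      omega

lemma lp_up (s j : ℕ) (hj : j ≤ s) :
    ∃ l : List ℕ, IsMonoPath (s + 1) (2 ^ (s - j)) (2 ^ (s + 1) - 1) l ∧ l.length = s + j + 1 := by
  induction j with
  | zero =>
    have h := lp_down (s + 1) s le_rfl
    have e : 2 ^ (s + 1) - 2 ^ s = 2 ^ s := by rw [pow_succ]; omega
    rw [e] at h
    simpa using h
  | succ j ih =>
    refine lp_cons (y := 2 ^ (s - j)) ⟨s - (j + 1), dvd_rfl, ?_⟩
      (Nat.pow_le_pow_right (by norm_num) (by omega)) (ih (by omega))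
    have : s - j = s - (j + 1) + 1 := by omega
    rw [this, pow_succ]; omega

/-- A step from a positive `x < 2^m` does not jump over `2^m`. -/
lemma lp_step {x y m : ℕ} (hx : 0 < x) (hm : x < 2 ^ m) (h : LEdge x y) :
    x < y ∧ y ≤ 2 * x ∧ y ≤ 2 ^ m ∧ (y < 2 ^ m → 2 * y ≤ 2 ^ m + x) := by
  obtain ⟨r, hr, rfl⟩ := h
  have h0 : 0 < 2 ^ r := by positivity
  have h1 : 2 ^ r ≤ x := Nat.le_of_dvd hx hr
  have h2 : r < m := (Nat.pow_lt_pow_iff_right (by norm_num : 1 < 2)).1 (lt_of_le_of_lt h1 hm)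
  have h3 : 2 ^ r ∣ 2 ^ m := pow_dvd_pow 2 h2.le
  obtain ⟨d, hd⟩ : ∃ d, 2 ^ m = x + d := ⟨2 ^ m - x, by omega⟩
  have h4 : 2 ^ r ∣ d := by rw [hd] at h3; exact (Nat.dvd_add_right hr).1 h3
  have h5 : 2 ^ r ≤ d := Nat.le_of_dvd (by omega) h4
  refine ⟨by omega, by omega, by omega, fun h6 => ?_⟩
  have h7 : 2 ^ r ∣ d - 2 ^ r := Nat.dvd_sub h4 dvd_rfl
  have h8 : 2 ^ r ≤ d - 2 ^ r := Nat.le_of_dvd (by omega) h7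
  omega

lemma lp_lower (s : ℕ) (l : List ℕ) : ∀ x : ℕ, 0 < x → List.IsChain LEdge (x :: l) →
    (x :: l).getLast? = some (2 ^ (s + 1) - 1) →
    x < 2 ^ (s + 1) ∧ 2 ^ (s + 1) ≤ x + 2 ^ l.length ∧
      (x ≤ 2 ^ s → 2 ^ s * 2 ^ s ≤ x * 2 ^ l.length) := by
  have hp : 2 ^ (s + 1) = 2 * 2 ^ s := by ring
  have hs : 0 < 2 ^ s := by positivity
  induction l with
  | nil =>
    intro x hx _ h
    simp only [List.getLast?_singleton, Option.some.injEq] at h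
    refine ⟨by omega, by simp; omega, fun h' => ?_⟩
    have : 2 ^ s = 1 := by omega
    simp [this]; omega
  | cons y l ih =>
    intro x hx hc h
    rw [List.getLast?_cons_cons] at h
    rw [List.isChain_cons_cons] at hc
    have hxy : x < y := by
      obtain ⟨r, _, rfl⟩ := hc.1
      have : 0 < 2 ^ r := by positivity
      omega
    obtain ⟨h1, h2, h3⟩ := ih y (by omega) hc.2 h
    have hx1 : x < 2 ^ (s + 1) := by omega
    obtain ⟨_, _, _, h4⟩ := lp_step hx hx1 hc.1
    have h5 := h4 h1
    have key : 2 ^ (s + 1) ≤ x + 2 ^ (y :: l).length := by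
      rw [List.length_cons, pow_succ 2 l.length]; omega
    refine ⟨hx1, key, fun h6 => ?_⟩
    rcases h6.eq_or_lt with h7 | h7
    · rw [h7] at key ⊢
      exact Nat.mul_le_mul_left _ (by omega)
    · obtain ⟨_, h8, h9, _⟩ := lp_step hx h7 hc.1
      calc 2 ^ s * 2 ^ s ≤ y * 2 ^ l.length := h3 h9
        _ ≤ (2 * x) * 2 ^ l.length := Nat.mul_le_mul_right _ h8
        _ = x * 2 ^ (y :: l).length := by rw [List.length_cons, pow_succ]; ring

/-- For every `t ≥ 2`, the minimal length of a monotone path in the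
log-path graph `L_t` from the vertex `1` to the vertex `2^t − 1` is exactly `2(t − 1)`. -/
theorem logpath_extremal_shortest_path (t : ℕ) (ht : 2 ≤ t) :
    IsLeast {n : ℕ | ∃ l : List ℕ, IsMonoPath t 1 (2 ^ t - 1) l ∧ l.length - 1 = n}
      (2 * (t - 1)) := by
  obtain ⟨s, rfl⟩ : ∃ s, t = s + 1 := ⟨t - 1, by omega⟩
  constructor
  · obtain ⟨l, h1, h2⟩ := lp_up s s le_rfl
    refine ⟨l, by simpa using h1, by omega⟩
  · rintro n ⟨l, ⟨h1, _, h3, h4⟩, rfl⟩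
    cases l with
    | nil => simp at h3
    | cons a l =>
      simp only [List.head?_cons, Option.some.injEq] at h3
      subst h3
      have h := (lp_lower s l 1 one_pos h1 h4).2.2 Nat.one_le_two_pow
      rw [one_mul, ← pow_add, Nat.pow_le_pow_iff_right (by norm_num)] at h
      simp only [List.length_cons]
      omega
end

section
/- Every simple cycle in the log-path graph L_t has a unique longest edge: if W is a cycle in L_t with pairwise distinct vertices, then among the edges {a, b} of W there is exactly one maximizing the length |b − a|. -/
/-- Adjacency in the log-path graph: `{x, y}` is an edge iff, written with the smaller
vertex first, it satisfies `LEdge`. -/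
def LAdj (x y : ℕ) : Prop := LEdge x y ∨ LEdge y x

/-- The (ordered) list of edges of a closed walk with vertex list `W`:
consecutive pairs of `W`, including the closing edge from the last vertex to the first. -/
def cycleEdges (W : List ℕ) : List (ℕ × ℕ) := W.zip (W.rotate 1)

/-- The length of an edge `{x, y}`, namely `|y − x|`. -/
def edgeLen (e : ℕ × ℕ) : ℕ := max e.1 e.2 - min e.1 e.2

/-- A simple cycle in the log-path graph `L_t`: a closed walk of length at least `3`
with pairwise distinct vertices, all in `{0, …, 2^t}`, each consecutive pair (cyclically)
being adjacent in `L_t`. -/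
def IsSimpleCycle (t : ℕ) (W : List ℕ) : Prop :=
  3 ≤ W.length ∧ W.Nodup ∧ (∀ v ∈ W, v ≤ 2 ^ t) ∧ ∀ e ∈ cycleEdges W, LAdj e.1 e.2

lemma ledge_nocross {x y r p : ℕ} (h : LEdge x y) (hl : y - x ≤ 2 ^ r) (hp : 2 ^ r ∣ p)
    (hx : x < p) : y ≤ p := by
  obtain ⟨s, hs, rfl⟩ := h
  have h1 : 2 ^ s ≤ 2 ^ r := by omega
  have h2 : s ≤ r := (Nat.pow_le_pow_iff_right (by norm_num)).1 h1
  obtain ⟨c, rfl⟩ := hs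
  obtain ⟨q, rfl⟩ := (pow_dvd_pow 2 h2).trans hp
  have h3 : c < q := lt_of_mul_lt_mul_left hx (Nat.zero_le _)
  calc 2 ^ s * c + 2 ^ s = 2 ^ s * (c + 1) := by ring
    _ ≤ _ := Nat.mul_le_mul_left _ h3

lemma ladj_nocross {x y r p : ℕ} (h : LAdj x y) (hl : edgeLen (x, y) ≤ 2 ^ r) (hp : 2 ^ r ∣ p) :
    (x < p → y ≤ p) ∧ (p < x → p ≤ y) := by
  simp only [edgeLen] at hl
  rcases h with h | h
  · have h0 : x < y := by
      obtain ⟨s, hs, rfl⟩ := h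
      have := Nat.two_pow_pos s
      omega
    exact ⟨ledge_nocross h (by omega) hp, by omega⟩
  · have h0 : y < x := by
      obtain ⟨s, hs, rfl⟩ := h
      have := Nat.two_pow_pos s
      omega
    refine ⟨by omega, fun h1 => ?_⟩
    by_contra h2
    have := ledge_nocross h (by omega) hp (by omega : y < p)
    omega

lemma side_aux {n p k : ℕ} {v : ℕ → ℕ} (hn : 3 ≤ n)
    (hinj : ∀ i j, v i = v j → i % n = j % n)
    (hper : ∀ i j, i % n = j % n → v i = v j)
    (hc : ∀ i, (v i < p → v (i + 1) ≤ p) ∧ (p < v i → p ≤ v (i + 1)))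
    (hk : v k = p) : (∀ i, p ≤ v i) ∨ (∀ i, v i ≤ p) := by
  have hne : ∀ j, 1 ≤ j → j < n → v (k + j) ≠ p := by
    intro j h1 h2 h3
    have h4 : (k + j) ≡ k + 0 [MOD n] := hinj _ _ (h3.trans hk.symm)
    have h5 := Nat.ModEq.add_left_cancel' k h4
    rw [Nat.ModEq, Nat.mod_eq_of_lt h2, Nat.zero_mod] at h5
    omega
  have hrep : ∀ i, ∃ j, j < n ∧ v i = v (k + j) := by
    intro i
    refine ⟨(i + (n - k % n)) % n, Nat.mod_lt _ (by omega), hper _ _ ?_⟩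
    have hlt := Nat.mod_lt k (show 0 < n by omega)
    have e : k + (i + (n - k % n)) = i + n * (k / n + 1) := by
      have := Nat.div_add_mod k n
      rw [Nat.mul_add]
      omega
    rw [Nat.add_mod_mod, e, Nat.add_mul_mod_self_left]
  rcases lt_or_gt_of_ne (hne 1 le_rfl (by omega)) with h | h
  · right
    have key : ∀ j, 1 ≤ j → j < n → v (k + j) < p := by
      intro j h1
      induction j, h1 using Nat.le_induction with
      | base => intro _; exact h
      | succ m hm ih =>
        intro hlt
        have a := (hc (k + m)).1 (ih (by omega))
        have b := hne (m + 1) (by omega) hlt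
        rw [← add_assoc] at b ⊢
        omega
    intro i
    obtain ⟨j, hj, e⟩ := hrep i
    rcases Nat.eq_zero_or_pos j with rfl | h0
    · rw [e, add_zero, hk]
    · rw [e]; exact (key j h0 hj).le
  · left
    have key : ∀ j, 1 ≤ j → j < n → p < v (k + j) := by
      intro j h1
      induction j, h1 using Nat.le_induction with
      | base => intro _; exact h
      | succ m hm ih =>
        intro hlt
        have a := (hc (k + m)).2 (ih (by omega))
        have b := hne (m + 1) (by omega) hlt
        rw [← add_assoc] at b ⊢
        omega
    intro i
    obtain ⟨j, hj, e⟩ := hrep i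
    rcases Nat.eq_zero_or_pos j with rfl | h0
    · rw [e, add_zero, hk]
    · rw [e]; exact (key j h0 hj).le

lemma ladj_form {x y : ℕ} (h : LAdj x y) :
    ∃ r a, 2 ^ r ∣ a ∧ edgeLen (x, y) = 2 ^ r ∧
      ((x = a ∧ y = a + 2 ^ r) ∨ (y = a ∧ x = a + 2 ^ r)) := by
  rcases h with ⟨r, h1, h2⟩ | ⟨r, h1, h2⟩
  · exact ⟨r, x, h1, by simp only [edgeLen]; omega, Or.inl ⟨rfl, h2⟩⟩
  · exact ⟨r, y, h1, by simp only [edgeLen]; omega, Or.inr ⟨rfl, h2⟩⟩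

lemma cyc_unique {n : ℕ} {v : ℕ → ℕ} (hn : 3 ≤ n)
    (hinj : ∀ i j, v i = v j → i % n = j % n)
    (hper : ∀ i j, i % n = j % n → v i = v j)
    (hadj : ∀ i, LAdj (v i) (v (i + 1))) (k l : ℕ)
    (hk : ∀ i, edgeLen (v i, v (i + 1)) ≤ edgeLen (v k, v (k + 1)))
    (hl : ∀ i, edgeLen (v i, v (i + 1)) ≤ edgeLen (v l, v (l + 1))) :
    v l = v k ∧ v (l + 1) = v (k + 1) := by
  have heq := le_antisymm (hk l) (hl k)
  obtain ⟨r, a, ha, hr, hform⟩ := ladj_form (hadj k)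
  have hD := Nat.two_pow_pos r
  rw [hr] at hk heq
  have hca := fun i => ladj_nocross (hadj i) (hk i) ha
  have hcb := fun i => ladj_nocross (hadj i) (hk i) (Nat.dvd_add ha (dvd_refl (2 ^ r)))
  have hA : ∀ i, a ≤ v i := by
    rcases hform with ⟨h1, h2⟩ | ⟨h1, h2⟩
    · rcases side_aux hn hinj hper hca h1 with h | h
      · exact h
      · have := h (k + 1); omega
    · rcases side_aux hn hinj hper hca h1 with h | h
      · exact h
      · have := h k; omega
  have hB : ∀ i, v i ≤ a + 2 ^ r := by
    rcases hform with ⟨h1, h2⟩ | ⟨h1, h2⟩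
    · rcases side_aux hn hinj hper hcb h2 with h | h
      · have := h k; omega
      · exact h
    · rcases side_aux hn hinj hper hcb h2 with h | h
      · have := h (k + 1); omega
      · exact h
  have a1 := hA l
  have a2 := hA (l + 1)
  have b1 := hB l
  have b2 := hB (l + 1)
  simp only [edgeLen] at heq
  by_contra hcon
  have hs : v l = v (k + 1) ∧ v (l + 1) = v k := by omega
  have e1 : l ≡ k + 1 [MOD n] := hinj _ _ hs.1
  have e2 : l + 1 ≡ k [MOD n] := hinj _ _ hs.2
  have e3 : k + 2 ≡ k + 0 [MOD n] := (e1.add_right 1).symm.trans e2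
  have e4 := Nat.ModEq.add_left_cancel' k e3
  rw [Nat.ModEq, Nat.mod_eq_of_lt (by omega), Nat.zero_mod] at e4
  omega

/-- Every simple cycle in the log-path graph `L_t` has a unique
longest edge: among the edges of `W` there is exactly one maximizing the length. -/
theorem logpath_unique_longest_edge (t : ℕ) (W : List ℕ) (hW : IsSimpleCycle t W) :
    ∃! e : ℕ × ℕ, e ∈ cycleEdges W ∧ ∀ e' ∈ cycleEdges W, edgeLen e' ≤ edgeLen e := by
  obtain ⟨hn, hnd, -, hadj⟩ := hW
  have hpos : 0 < W.length := by omega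
  let v : ℕ → ℕ := fun i => W[i % W.length]'(Nat.mod_lt _ hpos)
  have hper : ∀ i j, i % W.length = j % W.length → v i = v j := by
    intro i j h
    simp only [v, h]
  have hinj : ∀ i j, v i = v j → i % W.length = j % W.length := by
    intro i j h
    exact (hnd.getElem_inj_iff).1 h
  have hmem : ∀ e, e ∈ cycleEdges W ↔ ∃ i, e = (v i, v (i + 1)) := by
    intro e
    rw [cycleEdges, List.mem_iff_getElem]
    constructor
    · rintro ⟨i, hi, rfl⟩
      have hi' : i < W.length := by simpa using hi
      refine ⟨i, ?_⟩
      simp [v, List.getElem_rotate, Nat.mod_eq_of_lt hi']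
    · rintro ⟨i, rfl⟩
      refine ⟨i % W.length, by simpa using Nat.mod_lt _ hpos, ?_⟩
      simp [v, List.getElem_rotate]
  have hadj' : ∀ i, LAdj (v i) (v (i + 1)) := fun i => hadj _ ((hmem _).2 ⟨i, rfl⟩)
  obtain ⟨k, -, hk⟩ := Finset.exists_max_image (Finset.range W.length)
    (fun i => edgeLen (v i, v (i + 1))) ⟨0, by simpa using hpos⟩
  have hk' : ∀ i, edgeLen (v i, v (i + 1)) ≤ edgeLen (v k, v (k + 1)) := by
    intro i
    have := hk (i % W.length) (by simpa using Nat.mod_lt _ hpos)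
    rwa [hper (i % W.length) i (by simp), hper (i % W.length + 1) (i + 1) (by simp)] at this
  refine ⟨(v k, v (k + 1)), ⟨(hmem _).2 ⟨k, rfl⟩, ?_⟩, ?_⟩
  · intro e' he'
    obtain ⟨i, rfl⟩ := (hmem _).1 he'
    exact hk' i
  · rintro e ⟨he, hmax⟩
    obtain ⟨l, rfl⟩ := (hmem _).1 he
    obtain ⟨h1, h2⟩ := cyc_unique hn hinj hper hadj' k l hk'
      (fun i => hmax _ ((hmem _).2 ⟨i, rfl⟩))
    rw [h1, h2]
end

section
/- Let W be a simple cycle in the log-path graph L_t and let {a, b} with a < b be a longest edge of W (an edge of W maximizing |y − x| over edges {x, y} of W). Then every vertex v of W satisfies a ≤ v ≤ b. -/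
theorem lp_nocross {a b x y : ℕ} (hab : a < b) (h : LAdj a b) (hxy : LEdge x y)
    (hl : y - x ≤ b - a) : y ≤ a ∨ (a ≤ x ∧ y ≤ b) ∨ b ≤ x := by
  have h' : LEdge a b := by
    rcases h with h | ⟨r, _, h⟩
    · exact h
    · have : 0 < 2 ^ r := by positivity
      omega
  obtain ⟨R, hR, rfl⟩ := h'
  obtain ⟨r, hr, rfl⟩ := hxy
  have hle : 2 ^ r ≤ 2 ^ R := by omega
  have hrR : r ≤ R := (Nat.pow_le_pow_iff_right (by norm_num)).1 hle
  have hd : 2 ^ r ∣ 2 ^ R := pow_dvd_pow 2 hrR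
  obtain ⟨m, rfl⟩ := hd.trans hR
  obtain ⟨M, hM⟩ := hd
  obtain ⟨k, rfl⟩ := hr
  rw [hM]
  rcases lt_or_ge k m with hk | hk
  · left
    have := Nat.mul_le_mul_left (2 ^ r) (show k + 1 ≤ m from hk)
    linarith
  · rcases lt_or_ge k (m + M) with hk2 | hk2
    · right; left
      have h1 := Nat.mul_le_mul_left (2 ^ r) hk
      have h2 := Nat.mul_le_mul_left (2 ^ r) (show k + 1 ≤ m + M from hk2)
      constructor <;> linarith
    · right; right
      have h2 := Nat.mul_le_mul_left (2 ^ r) hk2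
      linarith

theorem lp_nocross' {a b x y : ℕ} (hab : a < b) (h : LAdj a b) (hxy : LAdj x y)
    (hl : edgeLen (x, y) ≤ b - a) :
    (x ≤ a ∧ y ≤ a) ∨ (a ≤ x ∧ a ≤ y ∧ x ≤ b ∧ y ≤ b) ∨ (b ≤ x ∧ b ≤ y) := by
  simp only [edgeLen] at hl
  rcases hxy with hxy | hxy
  · have hlt : x ≤ y := by obtain ⟨r, _, rfl⟩ := hxy; omega
    have := lp_nocross hab h hxy (by omega)
    omega
  · have hlt : y ≤ x := by obtain ⟨r, _, rfl⟩ := hxy; omega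
    have := lp_nocross hab h hxy (by omega)
    omega

theorem lp_seq {a b n : ℕ} (hab : a < b) (hn : 3 ≤ n) (f : ℕ → ℕ)
    (hf : ∀ i < n, ∀ j < n, f i = f j → i = j)
    (hs : ∀ j, j + 1 < n → (f j ≤ a ∧ f (j+1) ≤ a) ∨
      (a ≤ f j ∧ a ≤ f (j+1) ∧ f j ≤ b ∧ f (j+1) ≤ b) ∨ (b ≤ f j ∧ b ≤ f (j+1)))
    (he : (f 0 = b ∧ f (n-1) = a) ∨ (f 0 = a ∧ f (n-1) = b)) :
    ∀ j < n, a ≤ f j ∧ f j ≤ b := by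
  have hne : ∀ j, 0 < j → j < n - 1 → f j ≠ a ∧ f j ≠ b := by
    intro j h0 h1
    have e1 : f j ≠ f 0 := fun h => by have := hf j (by omega) 0 (by omega) h; omega
    have e2 : f j ≠ f (n-1) := fun h => by have := hf j (by omega) (n-1) (by omega) h; omega
    omega
  have key : ∀ j, j + 1 < n - 1 → (f (j+1) < a ↔ f 1 < a) ∧ (b < f (j+1) ↔ b < f 1) := by
    intro j
    induction j with
    | zero => intro _; simp
    | succ j ih =>
      intro h
      have := ih (by omega)
      have := hne (j+1) (by omega) (by omega)
      have := hne (j+1+1) (by omega) (by omega)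
      have := hs (j+1) (by omega)
      omega
  have k0 := hs 0 (by omega)
  have k1 := hs (n-2) (by omega)
  have k2 := key (n-3) (by omega)
  have k3 := hne 1 (by omega) (by omega)
  rw [show n - 3 + 1 = n - 2 by omega] at k2
  rw [show n - 2 + 1 = n - 1 by omega] at k1
  have k4 := hne (n-2) (by omega) (by omega)
  rw [zero_add] at k0
  intro j hj
  rcases Nat.eq_zero_or_pos j with rfl | hp
  · omega
  rcases Nat.lt_or_ge j (n-1) with h | h
  · have k5 := key (j-1) (by omega)
    rw [show j - 1 + 1 = j by omega] at k5
    omega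
  · obtain rfl : j = n - 1 := by omega
    omega

theorem lp_mem_edges {W : List ℕ} {x y : ℕ} : (x, y) ∈ cycleEdges W ↔
    ∃ i, ∃ h : i < W.length, W[i] = x ∧
      W[(i+1) % W.length]'(Nat.mod_lt _ (by omega)) = y := by
  unfold cycleEdges
  rw [List.mem_iff_getElem]
  simp only [List.getElem_zip, List.getElem_rotate, Prod.mk.injEq, List.length_zip,
    List.length_rotate, min_self]

/-- If `{a, b}` (with `a < b`) is a longest edge of a simple cycle `W`
in the log-path graph `L_t`, then every vertex `v` of `W` satisfies `a ≤ v ≤ b`. -/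
theorem logpath_cycle_under_longest_edge (t : ℕ) (W : List ℕ) (hW : IsSimpleCycle t W)
    (a b : ℕ) (hab : a < b)
    (he : (a, b) ∈ cycleEdges W ∨ (b, a) ∈ cycleEdges W)
    (hmax : ∀ e ∈ cycleEdges W, edgeLen e ≤ b - a) :
    ∀ v ∈ W, a ≤ v ∧ v ≤ b := by
  obtain ⟨h3, hnd, -, hadj⟩ := hW
  have hAB : LAdj a b := by
    rcases he with he | he
    · exact hadj _ he
    · exact (hadj _ he).symm
  have hpos : 0 < W.length := by omega
  obtain ⟨i, hi, hi2⟩ : ∃ i, ∃ h : i < W.length,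
      (W[i] = a ∧ W[(i+1) % W.length]'(Nat.mod_lt _ hpos) = b) ∨
      (W[i] = b ∧ W[(i+1) % W.length]'(Nat.mod_lt _ hpos) = a) := by
    rcases he with he | he
    · obtain ⟨i, h, h2⟩ := lp_mem_edges.1 he
      exact ⟨i, h, Or.inl h2⟩
    · obtain ⟨i, h, h2⟩ := lp_mem_edges.1 he
      exact ⟨i, h, Or.inr h2⟩
  have hlast : (i + 1 + (W.length - 1)) % W.length = i := by
    rw [show i + 1 + (W.length - 1) = i + W.length by omega, Nat.add_mod_right,
      Nat.mod_eq_of_lt hi]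
  have main := lp_seq hab h3 (fun j => W[(i + 1 + j) % W.length]'(Nat.mod_lt _ hpos))
    (by
      intro p hp q hq h
      have h' := (hnd.getElem_inj_iff).1 h
      have h2 : p ≡ q [MOD W.length] := Nat.ModEq.add_left_cancel' (i+1) h'
      exact Nat.ModEq.eq_of_lt_of_lt h2 hp hq)
    (by
      intro j _
      have hm : (W[(i + 1 + j) % W.length]'(Nat.mod_lt _ hpos),
          W[(i + 1 + (j + 1)) % W.length]'(Nat.mod_lt _ hpos)) ∈ cycleEdges W := by
        refine lp_mem_edges.2 ⟨(i + 1 + j) % W.length, Nat.mod_lt _ hpos, rfl, ?_⟩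
        congr 1
        rw [Nat.mod_add_mod, add_assoc (i+1)]
      exact lp_nocross' hab hAB (hadj _ hm) (hmax _ hm))
    (by
      simp only [hlast, add_zero]
      tauto)
  intro v hv
  obtain ⟨k, hk, rfl⟩ := List.getElem_of_mem hv
  have := main ((k + (W.length - 1 - i)) % W.length) (Nat.mod_lt _ hpos)
  have e : (i + 1 + (k + (W.length - 1 - i)) % W.length) % W.length = k := by
    rw [Nat.add_mod_mod, show i + 1 + (k + (W.length - 1 - i)) = k + W.length by omega,
      Nat.add_mod_right, Nat.mod_eq_of_lt hk]
  simpa only [e] using this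
end

section
/- Let W be a simple cycle in the log-path graph L_t and let {a, b} with a < b be its longest edge. Then b − a ≥ 2 (so b − a = 2^q with q ≥ 1), and the midpoint (a + b)/2 = a + 2^{q−1} is a vertex of W. -/
theorem aux_arith (x y a b : ℕ) (hx : LEdge x y) (ha : LEdge a b) (hl : y - x ≤ b - a)
    (h1 : 2 * x < a + b) (h2 : a + b < 2 * y) : x = a ∧ y = b := by
  obtain ⟨r, ⟨m, rfl⟩, rfl⟩ := hx
  obtain ⟨q, ⟨l, rfl⟩, rfl⟩ := ha
  have hl' : 2 ^ r ≤ 2 ^ q := by omega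
  have hrq : r ≤ q := (Nat.pow_le_pow_iff_right (by norm_num)).1 hl'
  obtain ⟨d, rfl⟩ := Nat.exists_eq_add_of_le hrq
  have hp : 0 < 2 ^ r := by positivity
  rw [pow_add] at *
  rcases d with _ | d
  · have e1 : 2 ^ r * (2 * m) < 2 ^ r * (2 * l + 1) := by
      simp only [pow_zero, mul_one] at h1; linarith
    have e2 : 2 ^ r * (2 * l + 1) < 2 ^ r * (2 * m + 2) := by
      simp only [pow_zero, mul_one] at h2; linarith
    have e1 := Nat.lt_of_mul_lt_mul_left e1
    have e2 := Nat.lt_of_mul_lt_mul_left e2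
    have : m = l := by omega
    subst this
    simp
  · exfalso
    rw [pow_succ] at h1 h2
    have e1 : 2 ^ r * m < 2 ^ r * (2 ^ d * 2 * l + 2 ^ d) := by linarith
    have e2 : 2 ^ r * (2 ^ d * 2 * l + 2 ^ d) < 2 ^ r * (m + 1) := by linarith
    have e1 := Nat.lt_of_mul_lt_mul_left e1
    have e2 := Nat.lt_of_mul_lt_mul_left e2
    omega

theorem aux_switch (Q : ℕ → Prop) (s d : ℕ) (h0 : Q s) (h1 : ¬ Q (s + d)) :
    ∃ k, s ≤ k ∧ Q k ∧ ¬ Q (k + 1) := by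
  by_contra! h
  apply h1
  clear h1
  induction d with
  | zero => exact h0
  | succ d ih => exact h (s + d) (Nat.le_add_right s d) ih

theorem aux_mod (n i k : ℕ) (hn : 3 ≤ n) (h1 : k % n = (i + 1) % n)
    (h2 : (k + 1) % n = i % n) : False := by
  have h3 : (i + 2) ≡ i [MOD n] :=
    ((show k ≡ i + 1 [MOD n] from h1).add_right 1).symm.trans h2
  have h4 : 2 ≡ 0 [MOD n] := Nat.ModEq.add_left_cancel' i h3
  have h5 := (Nat.modEq_zero_iff_dvd).1 h4
  have := Nat.le_of_dvd (by norm_num) h5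
  omega

theorem aux_mid (t : ℕ) (W : List ℕ) (hW : IsSimpleCycle t W)
    (a b : ℕ) (hab : LEdge a b)
    (he : (a, b) ∈ cycleEdges W ∨ (b, a) ∈ cycleEdges W)
    (hmax : ∀ e ∈ cycleEdges W, edgeLen e ≤ b - a) : ∃ x ∈ W, 2 * x = a + b := by
  obtain ⟨hn, hnd, -, hadj⟩ := hW
  by_contra! hno
  have hlt : a < b := by
    obtain ⟨r, -, rfl⟩ := hab
    have : 0 < 2 ^ r := by positivity
    omega
  have hpos : 0 < W.length := by omega
  let f : ℕ → ℕ := fun k => W[k % W.length]'(Nat.mod_lt _ hpos)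
  have hfW : ∀ k, f k ∈ W := fun k => List.getElem_mem _
  have hinj : ∀ k l, f k = f l → k % W.length = l % W.length := fun k l h =>
    (hnd.getElem_inj_iff).1 h
  have hper : ∀ k, f (k + W.length) = f k := fun k => by simp [f]
  have hmem : ∀ k, (f k, f (k + 1)) ∈ cycleEdges W := by
    intro k
    have hk := Nat.mod_lt k hpos
    rw [cycleEdges, List.mem_iff_getElem]
    refine ⟨k % W.length, by simpa using hk, ?_⟩
    simp [f, List.getElem_rotate]
  have hex : ∀ e ∈ cycleEdges W, ∃ k, e = (f k, f (k + 1)) := by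
    intro e h
    rw [cycleEdges, List.mem_iff_getElem] at h
    obtain ⟨k, hk, rfl⟩ := h
    have hk' : k < W.length := by simpa using hk
    refine ⟨k, ?_⟩
    simp [f, List.getElem_rotate, Nat.mod_eq_of_lt hk']
  have key : ∀ x y, (x, y) ∈ cycleEdges W ∨ (y, x) ∈ cycleEdges W → 2 * x < a + b →
      a + b < 2 * y → x = a ∧ y = b := by
    intro x y h h1 h2
    have hxy : LEdge x y := by
      have h3 : LAdj x y := by
        rcases h with h | h
        · exact hadj _ h
        · exact (hadj _ h).symm
      rcases h3 with h3 | ⟨r, -, h3⟩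
      · exact h3
      · have : 0 < 2 ^ r := by positivity
        omega
    have hl : y - x ≤ b - a := by
      rcases h with h | h
      · have := hmax _ h
        simp only [edgeLen] at this; omega
      · have := hmax _ h
        simp only [edgeLen] at this; omega
    exact aux_arith x y a b hxy hab hl h1 h2
  rcases he with he | he
  · obtain ⟨i, hi⟩ := hex _ he
    obtain ⟨hi1, hi2⟩ := Prod.mk.inj hi
    obtain ⟨k, -, hk1, hk2⟩ := aux_switch (fun k => a + b < 2 * f k) (i + 1) (W.length - 1)
      (by simp only [← hi2]; omega)
      (by rw [show i + 1 + (W.length - 1) = i + W.length by omega, hper, ← hi1]; omega)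
    have hne := hno _ (hfW (k + 1))
    obtain ⟨h1, h2⟩ := key (f (k + 1)) (f k) (Or.inr (hmem k)) (by omega) hk1
    exact aux_mod _ i k hn (hinj _ _ (h2.trans hi2)) (hinj _ _ (h1.trans hi1))
  · obtain ⟨i, hi⟩ := hex _ he
    obtain ⟨hi1, hi2⟩ := Prod.mk.inj hi
    obtain ⟨k, -, hk1, hk2⟩ := aux_switch (fun k => 2 * f k < a + b) (i + 1) (W.length - 1)
      (by simp only [← hi2]; omega)
      (by rw [show i + 1 + (W.length - 1) = i + W.length by omega, hper, ← hi1]; omega)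
    have hne := hno _ (hfW (k + 1))
    obtain ⟨h1, h2⟩ := key (f k) (f (k + 1)) (Or.inl (hmem k)) hk1 (by omega)
    exact aux_mod _ i k hn (hinj _ _ (h1.trans hi2)) (hinj _ _ (h2.trans hi1))

/-- If `{a, b}` (with `a < b`) is the longest edge of a simple cycle `W`
in the log-path graph `L_t`, then `b − a ≥ 2` (so `b − a = 2^q` with `q ≥ 1`), and the
midpoint `(a + b)/2 = a + 2^(q−1)` is a vertex of `W`. -/
theorem logpath_cycle_midpoint (t : ℕ) (W : List ℕ) (hW : IsSimpleCycle t W)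
    (a b : ℕ) (hab : a < b)
    (he : (a, b) ∈ cycleEdges W ∨ (b, a) ∈ cycleEdges W)
    (hmax : ∀ e ∈ cycleEdges W, edgeLen e ≤ b - a) :
    2 ≤ b - a ∧ ∃ q : ℕ, 1 ≤ q ∧ b = a + 2 ^ q ∧ a + 2 ^ (q - 1) ∈ W := by
  have hE : LEdge a b := by
    have h3 : LAdj a b := by
      rcases he with h | h
      · exact hW.2.2.2 _ h
      · exact (hW.2.2.2 _ h).symm
    rcases h3 with h3 | ⟨r, -, h3⟩
    · exact h3
    · have : 0 < 2 ^ r := by positivity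
      omega
  obtain ⟨x, hx, hx2⟩ := aux_mid t W hW a b hE he hmax
  obtain ⟨q, -, rfl⟩ := hE
  rcases q with _ | q
  · simp at hx2; omega
  · have hp : 0 < 2 ^ q := by positivity
    rw [pow_succ] at hx2
    refine ⟨by rw [pow_succ]; omega, q + 1, by omega, rfl, ?_⟩
    have : x = a + 2 ^ q := by omega
    simpa [← this] using hx
end

section
/- For t ≥ 1, the map sending an interior vertex b ∈ {1, …, 2^t − 1} to the set T(b) = {b − 2^r, b, b + 2^r}, where r is the largest natural number with 2^r ∣ b, is a well-defined bijection from {1, …, 2^t − 1} onto the set of triangles (3-cliques) of the log-path graph L_t. -/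
/-- A triangle (3-clique) of the log-path graph `L_t`: a set of three pairwise adjacent
vertices of `L_t`. -/
def IsTriangle (t : ℕ) (s : Finset ℕ) : Prop :=
  s.card = 3 ∧ (∀ v ∈ s, v ≤ 2 ^ t) ∧ ∀ a ∈ s, ∀ b ∈ s, a ≠ b → LAdj a b

/-- The candidate triangle associated to an interior vertex `v`:
`{v − 2^r, v, v + 2^r}` where `r = padicValNat 2 v` is the largest natural number
with `2^r ∣ v` (for `v ≠ 0`). -/
def Tmap (v : ℕ) : Finset ℕ :=
  {v - 2 ^ padicValNat 2 v, v, v + 2 ^ padicValNat 2 v}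

lemma val_decomp (v : ℕ) (hv : 1 ≤ v) :
    ∃ m : ℕ, v = 2 ^ padicValNat 2 v * (2 * m + 1) := by
  obtain ⟨k, hk⟩ := (pow_padicValNat_dvd : 2 ^ padicValNat 2 v ∣ v)
  have hn : ¬ 2 ^ (padicValNat 2 v + 1) ∣ v :=
    pow_succ_padicValNat_not_dvd (by omega)
  rcases Nat.even_or_odd' k with ⟨m, hm | hm⟩
  · exfalso
    apply hn
    refine ⟨m, ?_⟩
    rw [pow_succ, mul_assoc, ← hm]
    exact hk
  · exact ⟨m, by rw [← hm]; exact hk⟩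

lemma val_eq (r m : ℕ) : padicValNat 2 (2 ^ r * (2 * m + 1)) = r := by
  rw [padicValNat.mul (by positivity) (by omega), padicValNat.prime_pow,
    padicValNat.eq_zero_of_not_dvd (by omega)]
  rfl

lemma LAdj.edge {a b : ℕ} (h : LAdj a b) (hab : a < b) : LEdge a b := by
  rcases h with h | ⟨r, _, h⟩
  · exact h
  · omega

lemma pow_double_le {i k : ℕ} (h : 2 ^ i < 2 ^ k) : 2 * 2 ^ i ≤ 2 ^ k := by
  have h1 : i < k := (Nat.pow_lt_pow_iff_right (by norm_num)).1 h
  have h2 : 2 ^ (i + 1) ≤ 2 ^ k := Nat.pow_le_pow_right (by norm_num) h1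
  rw [pow_succ] at h2
  omega

lemma tri_sorted {a b c : ℕ} (hab : a < b) (hbc : b < c) (h1 : LAdj a b) (h2 : LAdj b c)
    (h3 : LAdj a c) : Tmap b = {a, b, c} := by
  obtain ⟨i, _, hi⟩ := h1.edge hab
  obtain ⟨j, _, hj⟩ := h2.edge hbc
  obtain ⟨k, hk, hk'⟩ := h3.edge (hab.trans hbc)
  have e1 := @pow_double_le i k (by omega)
  have e2 := @pow_double_le j k (by omega)
  have e3 : 2 ^ k = 2 * 2 ^ i := by omega
  obtain ⟨m, hm⟩ := hk
  have hb : b = 2 ^ i * (2 * m + 1) := by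
    rw [hi, hm, e3]; ring
  have hv : padicValNat 2 b = i := by rw [hb]; exact val_eq i m
  unfold Tmap
  rw [hv]
  have ha : b - 2 ^ i = a := by omega
  have hc : b + 2 ^ i = c := by omega
  rw [ha, hc]

lemma tmap_triangle (t v : ℕ) (hv : 1 ≤ v) (hv' : v < 2 ^ t) : IsTriangle t (Tmap v) := by
  obtain ⟨m, hm⟩ := val_decomp v hv
  unfold Tmap
  generalize padicValNat 2 v = r at *
  have hp : 0 < 2 ^ r := by positivity
  have e1 : v - 2 ^ r = 2 ^ r * (2 * m) := by
    rw [hm, mul_add, mul_one, Nat.add_sub_cancel]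
  have hle : 2 ^ r ≤ v := by rw [hm]; exact Nat.le_mul_of_pos_right _ (by omega)
  have hd : 2 ^ r ∣ v := ⟨_, hm⟩
  have hrt : r ≤ t := by
    by_contra h
    have : 2 ^ t ≤ 2 ^ r := Nat.pow_le_pow_right (by norm_num) (by omega)
    omega
  have hub : v + 2 ^ r ≤ 2 ^ t := by
    have h1 : 2 ^ r ∣ 2 ^ t - v := Nat.dvd_sub (pow_dvd_pow 2 hrt) hd
    have := Nat.le_of_dvd (by omega) h1
    omega
  have A : LEdge (v - 2 ^ r) v := ⟨r, ⟨_, e1⟩, by omega⟩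
  have B : LEdge v (v + 2 ^ r) := ⟨r, hd, rfl⟩
  have C : LEdge (v - 2 ^ r) (v + 2 ^ r) :=
    ⟨r + 1, ⟨m, by rw [e1]; ring⟩, by rw [pow_succ]; omega⟩
  refine ⟨?_, ?_, ?_⟩
  · rw [Finset.card_eq_three]
    exact ⟨_, _, _, by omega, by omega, by omega, rfl⟩
  · intro x hx
    simp only [Finset.mem_insert, Finset.mem_singleton] at hx
    omega
  · intro a ha b hb hab
    simp only [Finset.mem_insert, Finset.mem_singleton] at ha hb
    unfold LAdj
    rcases ha with rfl | rfl | rfl <;> rcases hb with rfl | rfl | rfl <;>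
      first
      | exact absurd rfl hab
      | exact Or.inl (by assumption)
      | exact Or.inr (by assumption)

lemma tmap_inj (x y : ℕ) (hx : 1 ≤ x) (hy : 1 ≤ y) (h : Tmap x = Tmap y) : x = y := by
  have lx : 2 ^ padicValNat 2 x ≤ x := Nat.le_of_dvd hx pow_padicValNat_dvd
  have ly : 2 ^ padicValNat 2 y ≤ y := Nat.le_of_dvd hy pow_padicValNat_dvd
  have px : 0 < 2 ^ padicValNat 2 x := by positivity
  have py : 0 < 2 ^ padicValNat 2 y := by positivity
  unfold Tmap at h
  generalize 2 ^ padicValNat 2 x = p at *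
  generalize 2 ^ padicValNat 2 y = q at *
  have h1 : x ∈ ({y - q, y, y + q} : Finset ℕ) := by rw [← h]; simp
  have h2 : x - p ∈ ({y - q, y, y + q} : Finset ℕ) := by rw [← h]; simp
  have h3 : x + p ∈ ({y - q, y, y + q} : Finset ℕ) := by rw [← h]; simp
  simp only [Finset.mem_insert, Finset.mem_singleton] at h1 h2 h3
  omega

lemma exists_sorted (s : Finset ℕ) (h : s.card = 3) :
    ∃ a b c, a < b ∧ b < c ∧ s = {a, b, c} := by
  obtain ⟨x, y, z, h1, h2, h3, rfl⟩ := Finset.card_eq_three.1 h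
  rcases lt_or_gt_of_ne h1 with h1 | h1 <;> rcases lt_or_gt_of_ne h2 with h2 | h2 <;>
    rcases lt_or_gt_of_ne h3 with h3 | h3
  · exact ⟨x, y, z, h1, h3, rfl⟩
  · exact ⟨x, z, y, h2, h3, by ext; simp; tauto⟩
  · omega
  · exact ⟨z, x, y, h2, h1, by ext; simp; tauto⟩
  · exact ⟨y, x, z, h1, h2, by ext; simp; tauto⟩
  · omega
  · exact ⟨y, z, x, h3, h2, by ext; simp; tauto⟩
  · exact ⟨z, y, x, h3, h1, by ext; simp; tauto⟩

/-- For `t ≥ 1`, the map sending an interior vertex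
`b ∈ {1, …, 2^t − 1}` to `T(b) = {b − 2^r, b, b + 2^r}` (with `r` the largest natural
number such that `2^r ∣ b`) is a well-defined bijection from `{1, …, 2^t − 1}` onto the
set of triangles of `L_t`. -/
theorem logpath_triangle_bijection (t : ℕ) (ht : 1 ≤ t) :
    Set.BijOn Tmap (Set.Icc 1 (2 ^ t - 1)) {s : Finset ℕ | IsTriangle t s} := by
  refine ⟨?_, ?_, ?_⟩
  · intro v hv
    have hv' := hv.2
    exact tmap_triangle t v hv.1 (by have : 0 < 2 ^ t := by positivity
                                     omega)
  · intro x hx y hy h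
    exact tmap_inj x y hx.1 hy.1 h
  · intro s hs
    obtain ⟨h1, h2, h3⟩ := hs
    obtain ⟨a, b, c, hab, hbc, rfl⟩ := exists_sorted s h1
    have hc := h2 c (by simp)
    exact ⟨b, ⟨by omega, by omega⟩,
      tri_sorted hab hbc (h3 a (by simp) b (by simp) (by omega))
        (h3 b (by simp) c (by simp) (by omega)) (h3 a (by simp) c (by simp) (by omega))⟩
end

section
/- For every t ≥ 1 and all vertices j < ℓ of the log-path graph L_t, there exists a set S of edges of L_t with |S| ≤ 2t whose 𝔽₂-boundary equals {j, ℓ}, i.e., such that a vertex v is incident to an odd number of edges of S if and only if v ∈ {j, ℓ}. -/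
/-- chain with at most `c` edges, boundary `a + b` -/
def LCh (N c a b : ℕ) : Prop :=
  ∃ S : Finset (ℕ × ℕ), S.card ≤ c ∧ (∀ e ∈ S, LEdge e.1 e.2 ∧ e.2 ≤ N) ∧
    ∀ v : ℕ, (Odd ((S.filter fun e => e.1 = v ∨ e.2 = v).card) ↔ ¬ (v = a ↔ v = b))

theorem card_symmDiff_aux (A B : Finset (ℕ × ℕ)) :
    (symmDiff A B).card + 2 * (A ∩ B).card = A.card + B.card := by
  have h1 : (symmDiff A B).card = (A \ B).card + (B \ A).card := by
    rw [symmDiff_def]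
    exact Finset.card_union_of_disjoint disjoint_sdiff_sdiff
  have h2 := Finset.card_sdiff_add_card_inter A B
  have h3 := Finset.card_sdiff_add_card_inter B A
  rw [Finset.inter_comm B A] at h3
  omega

theorem LCh.trans {N c d a b e : ℕ} (h : LCh N c a b) (h' : LCh N d b e) :
    LCh N (c + d) a e := by
  obtain ⟨S, hS, hE, hB⟩ := h
  obtain ⟨T, hT, hF, hD⟩ := h'
  refine ⟨symmDiff S T, ?_, ?_, ?_⟩
  · have := card_symmDiff_aux S T
    omega
  · intro x hx
    rw [Finset.mem_symmDiff] at hx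
    rcases hx with hx | hx
    · exact hE x hx.1
    · exact hF x hx.1
  · intro v
    have hf : (symmDiff S T).filter (fun e => e.1 = v ∨ e.2 = v) =
        symmDiff (S.filter fun e => e.1 = v ∨ e.2 = v) (T.filter fun e => e.1 = v ∨ e.2 = v) := by
      ext x
      simp only [Finset.mem_filter, Finset.mem_symmDiff]
      tauto
    have h1 := card_symmDiff_aux (S.filter fun e => e.1 = v ∨ e.2 = v)
      (T.filter fun e => e.1 = v ∨ e.2 = v)
    have h2 := hB v
    have h3 := hD v
    rw [hf]
    have h4 : Odd (symmDiff (S.filter fun e => e.1 = v ∨ e.2 = v)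
        (T.filter fun e => e.1 = v ∨ e.2 = v)).card ↔
        ¬ (Odd (S.filter fun e => e.1 = v ∨ e.2 = v).card ↔
          Odd (T.filter fun e => e.1 = v ∨ e.2 = v).card) := by
      simp only [Nat.odd_iff]
      omega
    rw [h4, h2, h3]
    tauto

theorem LCh.symm {N c a b : ℕ} (h : LCh N c a b) : LCh N c b a := by
  obtain ⟨S, hS, hE, hB⟩ := h
  exact ⟨S, hS, hE, fun v => by rw [hB v]; tauto⟩

theorem LCh.mono {N c d a b : ℕ} (h : LCh N c a b) (hc : c ≤ d) : LCh N d a b := by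
  obtain ⟨S, hS, hE, hB⟩ := h
  exact ⟨S, hS.trans hc, hE, hB⟩

theorem LCh.refl (N a : ℕ) : LCh N 0 a a :=
  ⟨∅, by simp, by simp, by simp⟩

theorem LCh.edge {N x r : ℕ} (h : 2 ^ r ∣ x) (hN : x + 2 ^ r ≤ N) : LCh N 1 x (x + 2 ^ r) := by
  refine ⟨{(x, x + 2 ^ r)}, by simp, ?_, ?_⟩
  · intro e he
    rw [Finset.mem_singleton] at he
    subst he
    exact ⟨⟨r, h, rfl⟩, hN⟩
  · intro v
    have hp : 0 < 2 ^ r := by positivity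
    rw [Finset.filter_singleton]
    split_ifs with h1
    · simp only [Finset.card_singleton, odd_one, true_iff]
      simp only at h1
      omega
    · simp only [Finset.card_empty, Nat.not_odd_zero, false_iff, not_not]
      simp only at h1
      omega

theorem LCh.zero (N t : ℕ) : ∀ k n : ℕ, n < 2 ^ t → n * 2 ^ k ≤ N → LCh N t 0 (n * 2 ^ k) := by
  induction t with
  | zero =>
    intro k n hn _
    have : n = 0 := by simpa using hn
    subst this
    simpa using LCh.refl N 0
  | succ t ih =>
    intro k n hn hN
    have hm : n / 2 < 2 ^ t := by rw [pow_succ] at hn; omega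
    rcases Nat.even_or_odd' n with ⟨m, h | h⟩
    · have e : n * 2 ^ k = m * 2 ^ (k + 1) := by rw [h]; ring
      rw [e] at hN ⊢
      exact (ih (k + 1) m (by omega) hN).mono (by omega)
    · have e : n * 2 ^ k = m * 2 ^ (k + 1) + 2 ^ k := by rw [h]; ring
      rw [e] at hN ⊢
      exact (ih (k + 1) m (by omega) (le_trans (Nat.le_add_right _ _) hN)).trans
        (LCh.edge (Dvd.dvd.mul_left (pow_dvd_pow 2 (by omega)) m) hN)

theorem LCh.zero' (t n : ℕ) (ht : 1 ≤ t) (hn : n ≤ 2 ^ t) : LCh (2 ^ t) t 0 n := by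
  rcases hn.lt_or_eq with h | h
  · simpa using LCh.zero (2 ^ t) t 0 n h (by simpa using hn)
  · subst h
    have := LCh.edge (N := 2 ^ t) (x := 0) (r := t) (by simp) (by simp)
    rw [Nat.zero_add] at this
    exact this.mono ht

/-- For every `t ≥ 1` and vertices `j < ℓ` of the log-path graph `L_t`,
there is a set `S` of at most `2t` edges of `L_t` (edges recorded as ordered pairs
`(x, y)` with `x < y`) whose `𝔽₂`-boundary is `{j, ℓ}`: a vertex `v` is incident to an
odd number of edges of `S` iff `v ∈ {j, ℓ}`. -/
theorem logpath_short_chain (t j ℓ : ℕ) (ht : 1 ≤ t) (hjl : j < ℓ) (hl : ℓ ≤ 2 ^ t) :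
    ∃ S : Finset (ℕ × ℕ), S.card ≤ 2 * t ∧
      (∀ e ∈ S, LEdge e.1 e.2 ∧ e.2 ≤ 2 ^ t) ∧
      ∀ v : ℕ, (Odd ((S.filter fun e => e.1 = v ∨ e.2 = v).card) ↔ (v = j ∨ v = ℓ)) := by
  obtain ⟨S, hS, hE, hB⟩ :=
    (LCh.zero' t j ht (by omega)).symm.trans (LCh.zero' t ℓ ht hl)
  refine ⟨S, by omega, hE, fun v => ?_⟩
  rw [hB v]
  omega
end

section
/- For every t ∈ ℕ, the 𝔽₂-boundary map on triangles of the log-path graph L_t is injective: if S and S' are finite sets of triangles of L_t such that each edge of L_t lies in an odd number of triangles of S exactly when it lies in an odd number of triangles of S', then S = S'. Equivalently, the only finite set of triangles whose 𝔽₂-boundary is empty is the empty set. -/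
def LTri (a r : ℕ) : Finset ℕ := {a, a + 2 ^ r, a + 2 ^ (r + 1)}

lemma LAdj.edge_s13 {x y : ℕ} (h : LAdj x y) (hxy : x < y) : LEdge x y := by
  rcases h with h | ⟨r, -, h⟩
  · exact h
  · have : 0 < 2 ^ r := by positivity
    omega

lemma two_pow_add_aux {r s u : ℕ} (h : 2 ^ r + 2 ^ s = 2 ^ u) : r = s ∧ u = r + 1 := by
  have key : ∀ r s u : ℕ, 2 ^ r + 2 ^ s = 2 ^ u → r ≤ s := by
    intro r s u h
    by_contra! hlt
    have h1 : 2 ^ s < 2 ^ r := Nat.pow_lt_pow_right (by norm_num) hlt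
    have h2 : 2 ^ r < 2 ^ u := by
      have : 0 < 2 ^ s := by positivity
      omega
    have h3 : r < u := (Nat.pow_lt_pow_iff_right (by norm_num)).1 h2
    have h4 : 2 ^ (r + 1) ≤ 2 ^ u := Nat.pow_le_pow_right (by norm_num) h3
    rw [pow_succ] at h4
    omega
  have e : r = s := le_antisymm (key _ _ _ h) (key s r u (by omega))
  subst e
  refine ⟨rfl, ?_⟩
  have : 2 ^ u = 2 ^ (r + 1) := by rw [pow_succ]; omega
  exact Nat.pow_right_injective (le_refl 2) this

lemma tri_sorted_s13 {x y z : ℕ} (hxy : x < y) (hyz : y < z) (h1 : LAdj x y) (h2 : LAdj y z)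
    (h3 : LAdj x z) : ∃ a r, 2 ^ (r + 1) ∣ a ∧ ({x, y, z} : Finset ℕ) = LTri a r := by
  obtain ⟨r, hr, e1⟩ := h1.edge_s13 hxy
  obtain ⟨s, hs, e2⟩ := h2.edge_s13 hyz
  obtain ⟨u, hu, e3⟩ := h3.edge_s13 (hxy.trans hyz)
  obtain ⟨rfl, rfl⟩ := two_pow_add_aux (r := r) (s := s) (u := u) (by omega)
  exact ⟨x, r, hu, by rw [LTri, e3, e1]⟩

lemma tri_class {t : ℕ} {T : Finset ℕ} (h : IsTriangle t T) :
    ∃ a r, 2 ^ (r + 1) ∣ a ∧ T = LTri a r := by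
  obtain ⟨hc, -, hadj⟩ := h
  obtain ⟨x, y, z, hxy, hxz, hyz, rfl⟩ := Finset.card_eq_three.1 hc
  have A : ∀ a b c : ℕ, ({x, y, z} : Finset ℕ) = {a, b, c} → a < b → b < c →
      ∃ a r, 2 ^ (r + 1) ∣ a ∧ ({x, y, z} : Finset ℕ) = LTri a r := by
    intro a b c he hab hbc
    rw [he] at hadj ⊢
    exact tri_sorted_s13 hab hbc (hadj a (by simp) b (by simp) hab.ne)
      (hadj b (by simp) c (by simp) hbc.ne) (hadj a (by simp) c (by simp) (hab.trans hbc).ne)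
  rcases lt_or_gt_of_ne hxy with h1 | h1 <;> rcases lt_or_gt_of_ne hxz with h2 | h2 <;>
    rcases lt_or_gt_of_ne hyz with h3 | h3
  · exact A x y z rfl h1 h3
  · exact A x z y (by ext; simp; tauto) h2 h3
  · omega
  · exact A z x y (by ext; simp; tauto) h2 h1
  · exact A y x z (by ext; simp; tauto) h1 h2
  · omega
  · exact A y z x (by ext; simp; tauto) h3 h2
  · exact A z y x (by ext; simp; tauto) h3 h1

lemma tri_uniq {a r b s : ℕ} (ha : 2 ^ (r + 1) ∣ a) (hb : 2 ^ (s + 1) ∣ b)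
    (h1 : a ∈ LTri b s) (h2 : a + 2 ^ r ∈ LTri b s) : LTri b s = LTri a r ∨ s < r := by
  have inj : ∀ m n : ℕ, 2 ^ m = 2 ^ n → m = n := fun m n h =>
    Nat.pow_right_injective (le_refl 2) h
  have pr : 0 < 2 ^ r := by positivity
  have ps : 0 < 2 ^ s := by positivity
  have e : 2 ^ (s + 1) = 2 ^ s + 2 ^ s := by ring
  simp only [LTri, Finset.mem_insert, Finset.mem_singleton] at h1 h2
  rcases h1 with h1 | h1 | h1 <;> rcases h2 with h2 | h2 | h2
  · omega
  · have := inj r s (by omega)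
    subst this; subst h1; exact Or.inl rfl
  · have := inj r (s + 1) (by omega)
    right; omega
  · omega
  · omega
  · have := inj r s (by omega)
    subst this
    exfalso
    rw [h1] at ha
    have := Nat.le_of_dvd pr ((Nat.dvd_add_right hb).1 ha)
    omega
  all_goals omega

lemma tri_mem (t : ℕ) (S S' : Finset (Finset ℕ))
    (hS : ∀ T ∈ S, IsTriangle t T) (hS' : ∀ T ∈ S', IsTriangle t T)
    (h : ∀ a b : ℕ, LEdge a b → b ≤ 2 ^ t →
      (Odd ((S.filter fun T => a ∈ T ∧ b ∈ T).card) ↔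
        Odd ((S'.filter fun T => a ∈ T ∧ b ∈ T).card))) (r : ℕ) :
    ∀ a, 2 ^ (r + 1) ∣ a → (LTri a r ∈ S ↔ LTri a r ∈ S') := by
  induction r using Nat.strong_induction_on with
  | _ r ih =>
  intro a ha
  by_cases hle : a + 2 ^ r ≤ 2 ^ t
  swap
  · have : ¬ IsTriangle t (LTri a r) := fun hT => hle (hT.2.1 _ (by simp [LTri]))
    exact ⟨fun hm => absurd (hS _ hm) this, fun hm => absurd (hS' _ hm) this⟩
  have hh := h a (a + 2 ^ r) ⟨r, (pow_dvd_pow 2 (Nat.le_succ r)).trans ha, rfl⟩ hle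
  have hE : (S.filter fun T => a ∈ T ∧ a + 2 ^ r ∈ T).erase (LTri a r) =
      (S'.filter fun T => a ∈ T ∧ a + 2 ^ r ∈ T).erase (LTri a r) := by
    ext T
    simp only [Finset.mem_erase, Finset.mem_filter]
    have aux : IsTriangle t T → T ≠ LTri a r → a ∈ T → a + 2 ^ r ∈ T → (T ∈ S ↔ T ∈ S') := by
      intro hT hne h1 h2
      obtain ⟨b, s, hb, rfl⟩ := tri_class hT
      rcases tri_uniq ha hb h1 h2 with h3 | h3
      · exact absurd h3 hne
      · exact ih s h3 b hb
    constructor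
    · rintro ⟨h0, h1, h2, h3⟩
      exact ⟨h0, (aux (hS T h1) h0 h2 h3).1 h1, h2, h3⟩
    · rintro ⟨h0, h1, h2, h3⟩
      exact ⟨h0, (aux (hS' T h1) h0 h2 h3).2 h1, h2, h3⟩
  have hm : ∀ U : Finset (Finset ℕ), LTri a r ∈ (U.filter fun T => a ∈ T ∧ a + 2 ^ r ∈ T) ↔
      LTri a r ∈ U := by
    intro U; simp [LTri]
  rw [← hm S, ← hm S']
  generalize (S.filter fun T => a ∈ T ∧ a + 2 ^ r ∈ T) = A at *
  generalize (S'.filter fun T => a ∈ T ∧ a + 2 ^ r ∈ T) = B at *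
  have hc := congrArg Finset.card hE
  rw [Finset.card_erase_eq_ite, Finset.card_erase_eq_ite] at hc
  rw [Nat.odd_iff, Nat.odd_iff] at hh
  by_cases hA : LTri a r ∈ A <;> by_cases hB : LTri a r ∈ B <;> simp only [hA, hB, if_true, if_false] at hc ⊢
  · have := Finset.card_pos.2 ⟨_, hA⟩
    omega
  · have := Finset.card_pos.2 ⟨_, hB⟩
    omega

/-- The `𝔽₂`-boundary map on triangles of the log-path graph `L_t` is
injective: if `S` and `S'` are finite sets of triangles of `L_t` such that every edge of
`L_t` (a pair `a < b ≤ 2^t` with `LEdge a b`) lies in an odd number of triangles of `S`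
exactly when it lies in an odd number of triangles of `S'`, then `S = S'`. -/
theorem logpath_triangle_boundary_injective (t : ℕ) (S S' : Finset (Finset ℕ))
    (hS : ∀ T ∈ S, IsTriangle t T) (hS' : ∀ T ∈ S', IsTriangle t T)
    (h : ∀ a b : ℕ, LEdge a b → b ≤ 2 ^ t →
      (Odd ((S.filter fun T => a ∈ T ∧ b ∈ T).card) ↔
        Odd ((S'.filter fun T => a ∈ T ∧ b ∈ T).card))) :
    S = S' := by
  ext T
  constructor
  · intro hT
    obtain ⟨a, r, ha, rfl⟩ := tri_class (hS T hT)
    exact (tri_mem t S S' hS hS' h r a ha).1 hT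
  · intro hT
    obtain ⟨a, r, ha, rfl⟩ := tri_class (hS' T hT)
    exact (tri_mem t S S' hS hS' h r a ha).2 hT
end

section
/- Let W be a simple cycle in the log-path graph L_t with longest edge {a, b}, a < b. For each vertex v of W with v ∉ {a, b}, one has 0 < v < 2^t, and letting T(v) = {v − 2^r, v, v + 2^r} with r the largest natural number such that 2^r ∣ v, each T(v) is a triangle of L_t. Moreover the 𝔽₂-boundary of the set {T(v) : v a vertex of W, v ∉ {a, b}} equals the edge set of W: an edge of L_t lies in an odd number of these triangles if and only if it is an edge of W. -/
/-- consecutive pairs of the walk `x, l, z`. -/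
def pathE : ℕ → List ℕ → ℕ → List (ℕ × ℕ)
  | x, [], z => [(x, z)]
  | x, y :: l, z => (x, y) :: pathE y l z

theorem zip_pathE (x : ℕ) (l : List ℕ) (z : ℕ) : (x :: l).zip (l ++ [z]) = pathE x l z := by
  induction l generalizing x with
  | nil => rfl
  | cons y l ih =>
    have := ih y
    simp only [List.cons_append, List.zip_cons_cons] at this ⊢
    simp [pathE, this]

theorem cycleEdges_cons (x : ℕ) (l : List ℕ) : cycleEdges (x :: l) = pathE x l x := by
  rw [← zip_pathE]; simp [cycleEdges]

theorem pathE_append (x : ℕ) (l : List ℕ) (y : ℕ) (m : List ℕ) (z : ℕ) :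
    pathE x (l ++ y :: m) z = pathE x l y ++ pathE y m z := by
  induction l generalizing x with
  | nil => rfl
  | cons w l ih => simp [pathE, ih]

theorem mem_pathE {x : ℕ} {l : List ℕ} {z : ℕ} {e : ℕ × ℕ} (h : e ∈ pathE x l z) :
    (e.1 = x ∨ e.1 ∈ l) ∧ (e.2 ∈ l ∨ e.2 = z) := by
  induction l generalizing x with
  | nil => simp [pathE] at h; simp [h]
  | cons w l ih =>
    simp only [pathE, List.mem_cons] at h
    rcases h with rfl | h
    · simp
    · have := ih h
      simp only [List.mem_cons]
      tauto

theorem pq_not_mem {p q : ℕ} {M : List ℕ} (hM : M ≠ []) (h1 : p ∉ M) (h2 : q ∉ M) (hpq : p ≠ q) :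
    (p, q) ∉ pathE p M q ∧ (q, p) ∉ pathE p M q := by
  constructor
  · cases M with
    | nil => exact absurd rfl hM
    | cons w M =>
      intro h
      simp only [pathE, List.mem_cons, Prod.mk.injEq] at h
      simp only [List.mem_cons] at h1 h2
      rcases h with h | h
      · tauto
      · have := (mem_pathE h).1
        simp only at this
        tauto
  · intro h
    have := mem_pathE h
    simp only at this
    tauto

theorem cycleEdges_rot {W W' : List ℕ} (h : W ~r W') : cycleEdges W ~r cycleEdges W' := by
  obtain ⟨n, rfl⟩ := h
  refine ⟨n, ?_⟩
  unfold cycleEdges List.zip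
  rw [List.zipWith_rotate_distrib _ _ _ _ (by simp)]
  simp only [List.rotate_rotate]
  rw [Nat.add_comm]

theorem exists_rot {W : List ℕ} (h3 : 3 ≤ W.length) {v : ℕ} (hv : v ∈ W) :
    ∃ p M q, W ~r (v :: p :: (M ++ [q])) := by
  obtain ⟨l1, l2, rfl⟩ := List.append_of_mem hv
  have hr : (l1 ++ v :: l2) ~r (v :: (l2 ++ l1)) := by
    have := List.isRotated_append (l := l1) (l' := v :: l2)
    simpa using this
  have hl : 2 ≤ (l2 ++ l1).length := by simp at h3 ⊢; omega
  generalize l2 ++ l1 = R at *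
  match R, hl with
  | p :: R', hl =>
    have : R' ≠ [] := by rintro rfl; simp at hl
    refine ⟨p, R'.dropLast, R'.getLast this, ?_⟩
    rw [List.dropLast_append_getLast]; exact hr

theorem cyc_big (v p : ℕ) (M : List ℕ) (q : ℕ) (e : ℕ × ℕ) :
    e ∈ cycleEdges (v :: p :: (M ++ [q])) ↔ e = (v, p) ∨ e ∈ pathE p M q ∨ e = (q, v) := by
  rw [cycleEdges_cons]
  show e ∈ (v, p) :: pathE p (M ++ [q]) v ↔ _
  rw [pathE_append]
  simp [pathE]

theorem cyc_small (p : ℕ) (M : List ℕ) (q : ℕ) (e : ℕ × ℕ) :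
    e ∈ cycleEdges (p :: (M ++ [q])) ↔ e ∈ pathE p M q ∨ e = (q, p) := by
  rw [cycleEdges_cons, pathE_append]
  simp [pathE]

theorem LAdj_cases {v w : ℕ} (h : LAdj v w) :
    ∃ j, 2 ^ j ∣ v ∧ 2 ^ j ∣ w ∧ (w = v + 2 ^ j ∨ v = w + 2 ^ j) := by
  rcases h with ⟨j, h, rfl⟩ | ⟨j, h, rfl⟩
  · exact ⟨j, h, (Nat.dvd_add_right h).2 dvd_rfl, Or.inl rfl⟩
  · exact ⟨j, (Nat.dvd_add_right h).2 dvd_rfl, h, Or.inr rfl⟩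

theorem LAdj_symm {v w : ℕ} (h : LAdj v w) : LAdj w v := h.symm

theorem edgeLen_of {v w d : ℕ} (h : w = v + d ∨ v = w + d) : edgeLen (v, w) = d := by
  unfold edgeLen
  rcases h with rfl | rfl <;> simp

/-- Some vertex is not divisible by the length of the longest edge. -/
theorem exists_low {t : ℕ} {W : List ℕ} (hW : IsSimpleCycle t W) {s : ℕ}
    (hmax : ∀ e ∈ cycleEdges W, edgeLen e ≤ 2 ^ s) : ∃ w ∈ W, ¬ 2 ^ s ∣ w := by
  by_contra! hall
  obtain ⟨h3, hnd, -, hadj⟩ := hW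
  obtain ⟨m, hm, hmm⟩ : ∃ m ∈ W, ∀ w ∈ W, w ≤ m := by
    have hne : W.toFinset.Nonempty := by
      rw [List.toFinset_nonempty_iff]; rintro rfl; simp at h3
    obtain ⟨m, hm, h⟩ := Finset.exists_max_image W.toFinset id hne
    exact ⟨m, by simpa using hm, fun w hw => h w (by simpa using hw)⟩
  obtain ⟨p, M, q, hr⟩ := exists_rot h3 hm
  have hE := fun e => (cycleEdges_rot hr).perm.mem_iff (a := e)
  have hmem := fun e => hr.perm.mem_iff (a := e)
  have hnd' := hr.perm.nodup_iff.1 hnd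
  have hpq : p ≠ q := by rintro rfl; simp at hnd'
  have key : ∀ w ∈ W, ((m, w) ∈ cycleEdges W ∨ (w, m) ∈ cycleEdges W) → m = w + 2 ^ s := by
    intro w hw he
    have hA : LAdj m w := by
      rcases he with he | he
      · exact hadj _ he
      · exact (hadj _ he).symm
    obtain ⟨j, h1, h2, h3⟩ := LAdj_cases hA
    have hle := hmm w hw
    have hpos : 0 < 2 ^ j := by positivity
    have h4 : m = w + 2 ^ j := by omega
    have hj : 2 ^ j ≤ 2 ^ s := by
      rcases he with he | he
      · have := hmax _ he
        rwa [edgeLen_of h3] at this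
      · have := hmax _ he
        rwa [edgeLen_of h3.symm] at this
    have hd : 2 ^ s ∣ 2 ^ j := by
      have := hall m hm
      rw [h4] at this
      exact (Nat.dvd_add_right (hall w hw)).1 this
    have := Nat.le_of_dvd hpos hd
    omega
  have hp := key p ((hmem _).2 (by simp)) (Or.inl ((hE _).2 ((cyc_big ..).2 (by simp))))
  have hq := key q ((hmem _).2 (by simp)) (Or.inr ((hE _).2 ((cyc_big ..).2 (by simp))))
  omega

theorem exists_min {t : ℕ} {W : List ℕ} (hW : IsSimpleCycle t W) {s : ℕ}
    (hmax : ∀ e ∈ cycleEdges W, edgeLen e ≤ 2 ^ s) :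
    ∃ r, r + 1 ≤ s ∧ (∀ w ∈ W, 2 ^ r ∣ w) ∧ ∃ v ∈ W, ¬ 2 ^ (r + 1) ∣ v := by
  have h := exists_low hW hmax
  classical
  have hex : ∃ k, ∃ w ∈ W, ¬ 2 ^ k ∣ w := ⟨s, h⟩
  have h1 := Nat.find_spec hex
  have h2 := Nat.find_min' hex h
  have h3 := fun m => Nat.find_min hex (m := m)
  generalize Nat.find hex = k at *
  cases k with
  | zero => simp at h1
  | succ r =>
    refine ⟨r, h2, ?_, h1⟩
    have := h3 r (by omega)
    push Not at this
    exact this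

theorem Tmap_eq {v r : ℕ} (h1 : 2 ^ r ∣ v) (h2 : ¬ 2 ^ (r + 1) ∣ v) :
    Tmap v = {v - 2 ^ r, v, v + 2 ^ r} := by
  have : padicValNat 2 v = r := by
    have h0 : v ≠ 0 := by rintro rfl; simp at h2
    rw [padicValNat_dvd_iff_le h0] at h1 h2
    omega
  unfold Tmap; rw [this]

theorem Tmap_inj {v w : ℕ} (hv : 0 < v) (hw : 0 < w) (h : Tmap v = Tmap w) : v = w := by
  have key : ∀ v, 0 < v → ∑ x ∈ Tmap v, x = 3 * v := by
    intro v hv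
    have hle : 2 ^ padicValNat 2 v ≤ v := Nat.le_of_dvd hv pow_padicValNat_dvd
    have hpos : 0 < 2 ^ padicValNat 2 v := by positivity
    unfold Tmap
    generalize 2 ^ padicValNat 2 v = d at *
    rw [Finset.sum_insert, Finset.sum_insert, Finset.sum_singleton]
    · omega
    · simp; omega
    · simp; omega
  have h1 := key v hv
  rw [h, key w hw] at h1
  omega

set_option maxHeartbeats 1000000 in
theorem core (t : ℕ) (a b s : ℕ) (hb : b = a + 2 ^ s) (hsa : 2 ^ s ∣ a) (n : ℕ) :
    ∀ W : List ℕ, W.length = n → IsSimpleCycle t W →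
    ((a, b) ∈ cycleEdges W ∨ (b, a) ∈ cycleEdges W) →
    (∀ e ∈ cycleEdges W, edgeLen e ≤ 2 ^ s) →
    (∀ v ∈ W, v ≠ a → v ≠ b → 0 < v ∧ v < 2 ^ t ∧ IsTriangle t (Tmap v)) ∧
    (∀ x y : ℕ, x < y →
      (Odd (((((W.toFinset.filter fun v => v ≠ a ∧ v ≠ b)).image Tmap).filter
          fun T => x ∈ T ∧ y ∈ T).card) ↔
        ((x, y) ∈ cycleEdges W ∨ (y, x) ∈ cycleEdges W))) := by
  induction n with
  | zero => intro W h hW; have := hW.1; omega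
  | succ n ih =>
  intro W hn hW he hmax
  obtain ⟨r, hrs, hdiv, v, hv, hvr⟩ := exists_min hW hmax
  obtain ⟨h3, hnd, hle, hadj⟩ := hW
  obtain ⟨p, M, q, hr⟩ := exists_rot h3 hv
  have hE : ∀ e, e ∈ cycleEdges W ↔ e = (v, p) ∨ e ∈ pathE p M q ∨ e = (q, v) := fun e =>
    (cycleEdges_rot hr).perm.mem_iff.trans (cyc_big v p M q e)
  have hmem : ∀ x, x ∈ W ↔ x = v ∨ x ∈ (p :: (M ++ [q])) := fun x => by
    rw [hr.perm.mem_iff, List.mem_cons]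
  have hnd' := hr.perm.nodup_iff.1 hnd
  have hlen : (p :: (M ++ [q])).length = n := by
    have := hr.perm.length_eq
    simp at this ⊢; omega
  obtain ⟨hvR, hndR⟩ := List.nodup_cons.1 hnd'
  have hvp : v ≠ p := by rintro rfl; simp at hvR
  have hvq : v ≠ q := by rintro rfl; simp at hvR
  have hvM : v ∉ M := by intro h; apply hvR; simp [h]
  have hpM : p ∉ M := by intro h; simp [h] at hndR
  have hqM : q ∉ M := by
    intro h
    have := (List.nodup_append.1 (List.nodup_cons.1 hndR).2).2.2 q h q (by simp)
    exact this rfl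
  have hpq : p ≠ q := by rintro rfl; simp at hndR
  -- divisibility
  have hra : 2 ^ (r + 1) ∣ a := (pow_dvd_pow 2 hrs).trans hsa
  have hrb : 2 ^ (r + 1) ∣ b := by
    rw [hb]; exact (Nat.dvd_add_right hra).2 (pow_dvd_pow 2 hrs)
  have hva : v ≠ a := by rintro rfl; exact hvr hra
  have hvb : v ≠ b := by rintro rfl; exact hvr hrb
  have hv0 : 0 < v := by
    rcases Nat.eq_zero_or_pos v with h | h
    · subst h; simp at hvr
    · exact h
  have nb : ∀ w ∈ W, LAdj v w → w = v + 2 ^ r ∨ v = w + 2 ^ r := by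
    intro w hw hA
    obtain ⟨j, h1, h2, h3⟩ := LAdj_cases hA
    have hj1 : j ≤ r := by
      by_contra hlt
      exact hvr ((pow_dvd_pow 2 (by omega)).trans h1)
    have hj2 : 2 ^ r ∣ 2 ^ j := by
      have d1 := hdiv v hv
      have d2 := hdiv w hw
      rcases h3 with h3 | h3
      · rw [h3] at d2; exact (Nat.dvd_add_right d1).1 d2
      · rw [h3] at d1; exact (Nat.dvd_add_right d2).1 d1
    have := (Nat.pow_dvd_pow_iff_le_right (by norm_num : 1 < 2)).1 hj2
    obtain rfl : j = r := by omega
    exact h3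
  have hAp : LAdj v p := hadj _ ((hE _).2 (Or.inl rfl))
  have hAq : LAdj v q := (hadj (q, v) ((hE _).2 (by simp))).symm
  have hpW : p ∈ W := (hmem p).2 (by simp)
  have hqW : q ∈ W := (hmem q).2 (by simp)
  have np := nb p hpW hAp
  have nq := nb q hqW hAq
  have hT0 := Tmap_eq (hdiv v hv) hvr
  have hvd : 2 ^ r ≤ v := Nat.le_of_dvd hv0 (hdiv v hv)
  have hd0 : 0 < 2 ^ r := by positivity
  have hpq2 : (p = v - 2 ^ r ∧ q = v + 2 ^ r) ∨ (q = v - 2 ^ r ∧ p = v + 2 ^ r) := by omega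
  have hT : Tmap v = {v, p, q} := by
    rw [hT0]; ext x; simp only [Finset.mem_insert, Finset.mem_singleton]; omega
  have hEd : LEdge (v - 2 ^ r) (v + 2 ^ r) := by
    refine ⟨r + 1, ?_, ?_⟩
    · obtain ⟨k, hk⟩ := hdiv v hv
      rcases Nat.even_or_odd' k with ⟨c, rfl | rfl⟩
      · exact absurd ⟨c, by rw [hk]; ring⟩ hvr
      · refine ⟨c, ?_⟩
        have : v = 2 ^ (r + 1) * c + 2 ^ r := by rw [hk]; ring
        omega
    · rw [pow_succ]; omega
  have hApq : LAdj p q := by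
    rcases hpq2 with ⟨h1, h2⟩ | ⟨h1, h2⟩
    · rw [h1, h2]; exact Or.inl hEd
    · rw [h1, h2]; exact Or.inr hEd
  have hTri : IsTriangle t (Tmap v) := by
    rw [hT]
    refine ⟨?_, ?_, ?_⟩
    · rw [Finset.card_eq_three]; exact ⟨v, p, q, hvp, hvq, hpq, rfl⟩
    · intro x hx
      simp only [Finset.mem_insert, Finset.mem_singleton] at hx
      rcases hx with rfl | rfl | rfl <;> exact hle _ (by assumption)
    · intro x hx y hy hxy
      simp only [Finset.mem_insert, Finset.mem_singleton] at hx hy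
      rcases hx with rfl | rfl | rfl <;> rcases hy with rfl | rfl | rfl <;>
        first
        | exact absurd rfl hxy
        | assumption
        | (apply LAdj_symm; assumption)
  have hvt : v < 2 ^ t := by
    have h1 := hle p hpW
    have h2 := hle q hqW
    omega
  have heE : (a, b) ∈ pathE p M q ∨ (b, a) ∈ pathE p M q := by
    rw [hE, hE] at he
    simp only [Prod.mk.injEq] at he
    rcases he with (h | h | h) | (h | h | h)
    · omega
    · exact Or.inl h
    · omega
    · omega
    · exact Or.inr h
    · omega
  -- edges of the path avoid v
  have hvE : ∀ x, (v, x) ∉ pathE p M q ∧ (x, v) ∉ pathE p M q := by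
    intro x
    constructor
    · intro h
      rcases (mem_pathE h).1 with h | h
      · exact hvp h
      · exact hvM h
    · intro h
      rcases (mem_pathE h).2 with h | h
      · exact hvM h
      · exact hvq h
  have hS : W.toFinset.filter (fun v => v ≠ a ∧ v ≠ b) =
      insert v ((p :: (M ++ [q])).toFinset.filter (fun v => v ≠ a ∧ v ≠ b)) := by
    ext x
    simp only [Finset.mem_filter, List.mem_toFinset, Finset.mem_insert, hmem]
    constructor
    · rintro ⟨h | h, h'⟩
      · exact Or.inl h
      · exact Or.inr ⟨h, h'⟩
    · rintro (rfl | h)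
      · exact ⟨Or.inl rfl, hva, hvb⟩
      · exact ⟨Or.inr h.1, h.2⟩
  by_cases hM : M = []
  · subst hM
    have hab' : (a = p ∧ b = q) ∨ (b = p ∧ a = q) := by
      simpa [pathE] using heE
    constructor
    · intro w hw h1 h2
      rw [hmem] at hw
      simp only [List.nil_append, List.mem_cons, List.not_mem_nil, or_false] at hw
      obtain rfl : w = v := by omega
      exact ⟨hv0, hvt, hTri⟩
    · intro x y hxy
      have hS0 : (p :: ([] ++ [q])).toFinset.filter (fun v => v ≠ a ∧ v ≠ b) = ∅ := by
        ext x
        simp only [List.nil_append, Finset.mem_filter, List.mem_toFinset, List.mem_cons,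
          List.not_mem_nil, or_false, Finset.notMem_empty, iff_false]
        omega
      rw [hS, hS0]
      simp only [Finset.image_singleton, insert_empty_eq, Finset.filter_singleton,
        hE, pathE, List.mem_singleton, Prod.mk.injEq]
      rw [hT]
      simp only [Finset.mem_insert, Finset.mem_singleton]
      split_ifs with hc
      · simp only [Finset.card_singleton, odd_one, true_iff]; omega
      · simp only [Finset.card_empty, Nat.not_odd_zero, false_iff]; omega
  · have hR3 : 3 ≤ (p :: (M ++ [q])).length := by
      have := List.length_pos_iff.2 hM
      simp; omega
    have hRE := cyc_small p M q
    have hlenqp : edgeLen (q, p) ≤ 2 ^ s := by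
      have h1 : edgeLen (q, p) = 2 ^ (r + 1) := by
        apply edgeLen_of
        rw [pow_succ]; omega
      rw [h1]; exact Nat.pow_le_pow_right (by norm_num) hrs
    obtain ⟨ih1, ih2⟩ := ih (p :: (M ++ [q])) hlen
      ⟨hR3, hndR, fun x hx => hle x ((hmem x).2 (Or.inr hx)), by
        intro e hee
        rcases (hRE e).1 hee with h | rfl
        · exact hadj e ((hE e).2 (Or.inr (Or.inl h)))
        · exact hApq.symm⟩
      (by rw [hRE, hRE]; exact heE.imp Or.inl Or.inl)
      (by
        intro e hee
        rcases (hRE e).1 hee with h | rfl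
        · exact hmax e ((hE e).2 (Or.inr (Or.inl h)))
        · exact hlenqp)
    constructor
    · intro w hw h1 h2
      rcases (hmem w).1 hw with rfl | hw
      · exact ⟨hv0, hvt, hTri⟩
      · exact ih1 w hw h1 h2
    · intro x y hxy
      have ih2 := ih2 x y hxy
      have hnot : Tmap v ∉ ((p :: (M ++ [q])).toFinset.filter
          (fun v => v ≠ a ∧ v ≠ b)).image Tmap := by
        intro h
        obtain ⟨w, hw, hwv⟩ := Finset.mem_image.1 h
        simp only [Finset.mem_filter, List.mem_toFinset] at hw
        have := Tmap_inj (ih1 w hw.1 hw.2.1 hw.2.2).1 hv0 hwv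
        subst this
        exact hvR hw.1
      rw [hS, Finset.image_insert, Finset.filter_insert]
      generalize ((p :: (M ++ [q])).toFinset.filter
          (fun v => v ≠ a ∧ v ≠ b)).image Tmap = I at *
      obtain ⟨n1, n2⟩ := pq_not_mem hM hpM hqM hpq
      rw [hRE, hRE] at ih2
      rw [hE, hE]
      have hTx : ∀ x, x ∈ Tmap v ↔ x = v ∨ x = p ∨ x = q := by
        intro x; rw [hT]; simp
      simp only [Prod.mk.injEq] at ih2 ⊢
      split_ifs with hc
      · rw [Finset.card_insert_of_notMem (by
          intro h; exact hnot (Finset.mem_filter.1 h).1), Nat.odd_add_one, ih2]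
        rw [hTx, hTx] at hc
        rcases hc with ⟨rfl | rfl | rfl, rfl | rfl | rfl⟩
        · omega
        · simp [hvE, hvp, hvq]
        · simp [hvE, hvp, hvq]
        · simp [hvE, hvp, hvq, hvp.symm]
        · omega
        · simp [n1, n2, hvp.symm, hvq.symm, hpq, hpq.symm]
        · simp [hvE, hvp, hvq, hvq.symm]
        · simp [n1, n2, hvp.symm, hvq.symm, hpq, hpq.symm]
        · omega
      · rw [ih2]
        rw [hTx, hTx] at hc
        have c1 : ¬ (x = q ∧ y = p) := by rintro ⟨rfl, rfl⟩; simp at hc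
        have c2 : ¬ (y = q ∧ x = p) := by rintro ⟨rfl, rfl⟩; simp at hc
        have c3 : ¬ (x = v ∧ y = p) := by rintro ⟨rfl, rfl⟩; simp at hc
        have c4 : ¬ (y = v ∧ x = p) := by rintro ⟨rfl, rfl⟩; simp at hc
        have c5 : ¬ (x = q ∧ y = v) := by rintro ⟨rfl, rfl⟩; simp at hc
        have c6 : ¬ (y = q ∧ x = v) := by rintro ⟨rfl, rfl⟩; simp at hc
        simp only [c1, c2, c3, c4, c5, c6, or_false, false_or]

/-- Let `W` be a simple cycle in the log-path graph `L_t` with longest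
edge `{a, b}`, `a < b`.  Every vertex `v` of `W` other than `a, b` satisfies
`0 < v < 2^t` and yields a triangle `T(v)` of `L_t`; moreover the `𝔽₂`-boundary of the
set `{T(v) : v ∈ W, v ∉ {a, b}}` is exactly the edge set of `W`: an edge of `L_t` lies
in an odd number of these triangles iff it is an edge of `W`. -/
theorem logpath_cycle_filling (t : ℕ) (W : List ℕ) (hW : IsSimpleCycle t W)
    (a b : ℕ) (hab : a < b)
    (he : (a, b) ∈ cycleEdges W ∨ (b, a) ∈ cycleEdges W)
    (hmax : ∀ e ∈ cycleEdges W, edgeLen e ≤ b - a) :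
    (∀ v ∈ W, v ≠ a → v ≠ b → 0 < v ∧ v < 2 ^ t ∧ IsTriangle t (Tmap v)) ∧
    (∀ x y : ℕ, LEdge x y → y ≤ 2 ^ t →
      (Odd (((((W.toFinset.filter fun v => v ≠ a ∧ v ≠ b)).image Tmap).filter
          fun T => x ∈ T ∧ y ∈ T).card) ↔
        ((x, y) ∈ cycleEdges W ∨ (y, x) ∈ cycleEdges W))) := by
  have hA : LAdj a b := by
    rcases he with he | he
    · exact hW.2.2.2 _ he
    · exact (hW.2.2.2 _ he).symm
  obtain ⟨s, h1, h2, h3⟩ := LAdj_cases hA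
  have hb : b = a + 2 ^ s := by
    have : 0 < 2 ^ s := by positivity
    omega
  obtain ⟨c1, c2⟩ := core t a b s hb h1 W.length W rfl hW he (by
    intro e hee
    have := hmax e hee
    omega)
  refine ⟨c1, fun x y hxy _ => c2 x y ?_⟩
  obtain ⟨k, -, rfl⟩ := hxy
  have : 0 < 2 ^ k := by positivity
  omega
end

section
/- Let t ∈ ℕ and let C be a nonempty finite set of edges of the log-path graph L_t such that every vertex of L_t is incident to an even number of edges of C (an 𝔽₂ 1-cycle). Then there exists a unique finite set S of triangles of L_t whose 𝔽₂-boundary equals C, and this S satisfies |S| ≤ |C| − 2. -/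
def tri (k r : ℕ) : Finset ℕ := {k * 2 ^ r, k * 2 ^ r + 2 ^ (r - 1), (k + 1) * 2 ^ r}

lemma ledge_lt {x y : ℕ} (h : LEdge x y) : x < y := by
  obtain ⟨r, _, rfl⟩ := h
  have : 0 < 2 ^ r := by positivity
  omega

lemma ledge_iff {x y : ℕ} : LEdge x y ↔ ∃ k r, x = k * 2 ^ r ∧ y = (k + 1) * 2 ^ r := by
  constructor
  · rintro ⟨r, ⟨k, rfl⟩, rfl⟩
    exact ⟨k, r, by ring, by ring⟩
  · rintro ⟨k, r, rfl, rfl⟩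
    exact ⟨r, ⟨k, by ring⟩, by ring⟩

lemma ledge_mk (k r : ℕ) : LEdge (k * 2 ^ r) ((k + 1) * 2 ^ r) := ledge_iff.2 ⟨k, r, rfl, rfl⟩

lemma code_inj {k r k' r' : ℕ} (h1 : k * 2 ^ r = k' * 2 ^ r')
    (h2 : (k + 1) * 2 ^ r = (k' + 1) * 2 ^ r') : k = k' ∧ r = r' := by
  have h : 2 ^ r = 2 ^ r' := by rw [add_mul, add_mul] at h2; omega
  have hr : r = r' := Nat.pow_right_injective le_rfl h
  subst hr
  exact ⟨Nat.eq_of_mul_eq_mul_right (by positivity) h1, rfl⟩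

lemma pow_sum {p q r : ℕ} (h : 2 ^ p + 2 ^ q = 2 ^ r) : p = q ∧ r = p + 1 := by
  have key : ∀ p q r : ℕ, 2 ^ p + 2 ^ q = 2 ^ r → ¬ p < q := by
    intro p q r h hpq
    have h0 : 0 < 2 ^ p := by positivity
    have h1 : 2 ^ p < 2 ^ q := Nat.pow_lt_pow_right (by norm_num) hpq
    have h2 : q < r := (Nat.pow_lt_pow_iff_right (by norm_num : 1 < 2)).1 (by omega)
    have h3 : 2 ^ (q + 1) ≤ 2 ^ r := Nat.pow_le_pow_right (by norm_num) h2
    rw [pow_succ] at h3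
    omega
  have h1 := key _ _ _ h
  have h2 := key q p r (by omega)
  have h3 : p = q := by omega
  subst h3
  refine ⟨rfl, ?_⟩
  apply Nat.pow_right_injective (le_refl 2)
  simp only [pow_succ]
  omega

lemma tri_of_sorted {a b c t : ℕ} (h1 : LEdge a b) (h2 : LEdge b c) (h3 : LEdge a c)
    (hc : c ≤ 2 ^ t) :
    ∃ k r, 1 ≤ r ∧ (k + 1) * 2 ^ r ≤ 2 ^ t ∧ ({a, b, c} : Finset ℕ) = tri k r := by
  obtain ⟨p, hp, rfl⟩ := h1
  obtain ⟨q, hq, rfl⟩ := h2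
  obtain ⟨r, ⟨k, rfl⟩, h⟩ := h3
  obtain ⟨rfl, rfl⟩ := pow_sum (p := p) (q := q) (r := r) (by omega)
  refine ⟨k, p + 1, by omega, ?_, ?_⟩
  · rw [h] at hc
    calc _ = _ := by ring
      _ ≤ _ := hc
  · unfold tri
    rw [h]
    simp only [Nat.add_sub_cancel]
    rw [mul_comm k, add_mul, one_mul, mul_comm k]

lemma tri_exists {t : ℕ} {T : Finset ℕ} (h : IsTriangle t T) :
    ∃ k r, 1 ≤ r ∧ (k + 1) * 2 ^ r ≤ 2 ^ t ∧ T = tri k r := by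
  obtain ⟨h3, hb, hadj⟩ := h
  obtain ⟨a, b, c, hab, hac, hbc, rfl⟩ := Finset.card_eq_three.1 h3
  have ha := hb a (by simp)
  have hb' := hb b (by simp)
  have hc := hb c (by simp)
  have e1 : ({a, c, b} : Finset ℕ) = {a, b, c} := by ext; simp; tauto
  have e2 : ({b, a, c} : Finset ℕ) = {a, b, c} := by ext; simp; tauto
  have e3 : ({b, c, a} : Finset ℕ) = {a, b, c} := by ext; simp; tauto
  have e4 : ({c, a, b} : Finset ℕ) = {a, b, c} := by ext; simp; tauto
  have e5 : ({c, b, a} : Finset ℕ) = {a, b, c} := by ext; simp; tauto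
  rcases hadj a (by simp) b (by simp) hab with h1 | h1 <;>
  rcases hadj a (by simp) c (by simp) hac with h2 | h2 <;>
  rcases hadj b (by simp) c (by simp) hbc with h3 | h3
  · exact tri_of_sorted h1 h3 h2 hc
  · rw [← e1]; exact tri_of_sorted h2 h3 h1 hb'
  · have := ledge_lt h1; have := ledge_lt h2; have := ledge_lt h3; omega
  · rw [← e4]; exact tri_of_sorted h2 h1 h3 hb'
  · rw [← e2]; exact tri_of_sorted h1 h2 h3 hc
  · have := ledge_lt h1; have := ledge_lt h2; have := ledge_lt h3; omega
  · rw [← e3]; exact tri_of_sorted h3 h2 h1 ha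
  · rw [← e5]; exact tri_of_sorted h3 h1 h2 ha

lemma tri_succ (k r : ℕ) :
    tri k (r + 1) = {(2 * k) * 2 ^ r, (2 * k + 1) * 2 ^ r, (2 * k + 2) * 2 ^ r} := by
  unfold tri
  have h1 : k * 2 ^ (r + 1) = (2 * k) * 2 ^ r := by ring
  have h2 : (k + 1) * 2 ^ (r + 1) = (2 * k + 2) * 2 ^ r := by ring
  have h3 : (2 * k) * 2 ^ r + 2 ^ r = (2 * k + 1) * 2 ^ r := by ring
  rw [h1, h2, Nat.add_sub_cancel, h3]

lemma tri_isTriangle {t k r : ℕ} (hr : 1 ≤ r) (hb : (k + 1) * 2 ^ r ≤ 2 ^ t) :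
    IsTriangle t (tri k r) := by
  obtain ⟨r, rfl⟩ : ∃ s, r = s + 1 := ⟨r - 1, by omega⟩
  have h1 : LEdge ((2 * k) * 2 ^ r) ((2 * k + 1) * 2 ^ r) := ledge_mk _ _
  have h2 : LEdge ((2 * k + 1) * 2 ^ r) ((2 * k + 2) * 2 ^ r) := ledge_mk _ _
  have h3 : LEdge ((2 * k) * 2 ^ r) ((2 * k + 2) * 2 ^ r) :=
    ledge_iff.2 ⟨k, r + 1, by ring, by ring⟩
  have hb' : (2 * k + 2) * 2 ^ r ≤ 2 ^ t := by
    calc _ = _ := by ring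
      _ ≤ _ := hb
  rw [tri_succ]
  have l1 := ledge_lt h1
  have l2 := ledge_lt h2
  generalize (2 * k) * 2 ^ r = a at *
  generalize (2 * k + 1) * 2 ^ r = b at *
  generalize (2 * k + 2) * 2 ^ r = c at *
  refine ⟨?_, ?_, ?_⟩
  · exact Finset.card_eq_three.2 ⟨a, b, c, by omega, by omega, by omega, rfl⟩
  · intro v hv
    simp at hv
    omega
  · intro x hx y hy hxy
    simp at hx hy
    unfold LAdj
    rcases hx with rfl | rfl | rfl <;> rcases hy with rfl | rfl | rfl <;> tauto

lemma tri_mem_s15 {k r k' r' : ℕ} (hr : 1 ≤ r') :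
    (k * 2 ^ r ∈ tri k' r' ∧ (k + 1) * 2 ^ r ∈ tri k' r') ↔
      ((k' = k ∧ r' = r) ∨ (k' = k / 2 ∧ r' = r + 1)) := by
  obtain ⟨s, rfl⟩ : ∃ s, r' = s + 1 := ⟨r' - 1, by omega⟩
  constructor
  · rw [tri_succ]
    rintro ⟨h1, h2⟩
    have hlt : k * 2 ^ r < (k + 1) * 2 ^ r := ledge_lt (ledge_mk k r)
    have hm : 0 < 2 ^ s := by positivity
    have e1 : (2 * k' + 1) * 2 ^ s = 2 * k' * 2 ^ s + 2 ^ s := by ring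
    have e2 : (2 * k' + 2) * 2 ^ s = 2 * k' * 2 ^ s + 2 * 2 ^ s := by ring
    simp only [Finset.mem_insert, Finset.mem_singleton] at h1 h2
    rcases h1 with h1 | h1 | h1 <;> rcases h2 with h2 | h2 | h2 <;> try omega
    · obtain ⟨h, rfl⟩ := code_inj h1 h2
      right; omega
    · obtain ⟨h, h'⟩ := code_inj (k' := k') (r' := s + 1) (h1.trans (by ring)) (h2.trans (by ring))
      left; omega
    · obtain ⟨h, rfl⟩ := code_inj h1 h2
      right; omega
  · rintro (⟨rfl, rfl⟩ | ⟨rfl, h⟩)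
    · simp [tri]
    · obtain rfl : s = r := by omega
      rw [tri_succ]
      rcases Nat.even_or_odd' k with ⟨j, rfl | rfl⟩
      · rw [show 2 * j / 2 = j by omega]; simp
      · rw [show (2 * j + 1) / 2 = j by omega]; simp

lemma tri_inj {k r k' r' : ℕ} (hr : 1 ≤ r) (hr' : 1 ≤ r') (h : tri k r = tri k' r') :
    k = k' ∧ r = r' := by
  have a := (tri_mem_s15 (k := k) (r := r) (k' := k') (r' := r') hr').1
    (h ▸ (tri_mem_s15 hr).2 (Or.inl ⟨rfl, rfl⟩))
  have b := (tri_mem_s15 (k := k') (r := r') (k' := k) (r' := r) hr).1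
    (h ▸ (tri_mem_s15 hr').2 (Or.inl ⟨rfl, rfl⟩))
  omega

lemma tri_zero_not {t k : ℕ} : ¬ IsTriangle t (tri k 0) := by
  rintro ⟨h, -⟩
  have : tri k 0 = {k, k + 1} := by simp [tri]
  rw [this] at h
  have := Finset.card_le_two (a := k) (b := k + 1)
  omega

lemma tri_bound {t k r : ℕ} (h : IsTriangle t (tri k r)) : 1 ≤ r ∧ (k + 1) * 2 ^ r ≤ 2 ^ t := by
  refine ⟨?_, h.2.1 _ (by simp [tri])⟩
  by_contra h0
  obtain rfl : r = 0 := by omega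
  exact tri_zero_not h

lemma odd_iff {t : ℕ} {S : Finset (Finset ℕ)} (hS : ∀ T ∈ S, IsTriangle t T) (k r : ℕ) :
    Odd ((S.filter fun T => k * 2 ^ r ∈ T ∧ (k + 1) * 2 ^ r ∈ T).card) ↔
      ¬ (tri k r ∈ S ↔ tri (k / 2) (r + 1) ∈ S) := by
  have hne : tri k r ∈ S → tri (k / 2) (r + 1) ∈ S → tri k r ≠ tri (k / 2) (r + 1) := by
    intro h1 h2 h
    have := tri_inj (tri_bound (hS _ h1)).1 (tri_bound (hS _ h2)).1 h
    omega
  have heq : (S.filter fun T => k * 2 ^ r ∈ T ∧ (k + 1) * 2 ^ r ∈ T) =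
      ({tri k r, tri (k / 2) (r + 1)} : Finset (Finset ℕ)).filter (· ∈ S) := by
    ext T
    simp only [Finset.mem_filter, Finset.mem_insert, Finset.mem_singleton]
    constructor
    · rintro ⟨hT, h⟩
      obtain ⟨k', r', hr', -, rfl⟩ := tri_exists (hS T hT)
      refine ⟨?_, hT⟩
      rcases (tri_mem_s15 hr').1 h with ⟨rfl, rfl⟩ | ⟨rfl, rfl⟩ <;> simp
    · rintro ⟨rfl | rfl, hT⟩
      · exact ⟨hT, (tri_mem_s15 (tri_bound (hS _ hT)).1).2 (by simp)⟩
      · exact ⟨hT, (tri_mem_s15 (tri_bound (hS _ hT)).1).2 (by simp)⟩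
  rw [heq]
  by_cases h1 : tri k r ∈ S <;> by_cases h2 : tri (k / 2) (r + 1) ∈ S
  · rw [Finset.filter_insert, Finset.filter_singleton]
    simp [h1, h2, Finset.card_pair (hne h1 h2)]
  all_goals
    rw [Finset.filter_insert, Finset.filter_singleton]
    simp [h1, h2]

lemma scale_le {t k r : ℕ} (h : (k + 1) * 2 ^ r ≤ 2 ^ t) : r ≤ t := by
  apply (Nat.pow_le_pow_iff_right (le_refl 2 : 1 < 2)).1
  nlinarith [Nat.zero_le (k * 2 ^ r)]

lemma nest {k r k' r' : ℕ} :
    (k' * 2 ^ r' ≤ k * 2 ^ r ∧ (k + 1) * 2 ^ r ≤ (k' + 1) * 2 ^ r') ↔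
      ((k' = k ∧ r' = r) ∨
        (k' * 2 ^ r' ≤ (k / 2) * 2 ^ (r + 1) ∧ (k / 2 + 1) * 2 ^ (r + 1) ≤ (k' + 1) * 2 ^ r')) := by
  have hm : 0 < 2 ^ r := by positivity
  constructor
  · rintro ⟨h1, h2⟩
    have h3 : 2 ^ r ≤ 2 ^ r' := by rw [add_mul, add_mul] at h2; omega
    have h4 := (Nat.pow_le_pow_iff_right (le_refl 2 : 1 < 2)).1 h3
    rcases Nat.lt_or_ge r r' with h | h
    · right
      obtain ⟨d, rfl⟩ : ∃ d, r' = r + 1 + d := ⟨r' - (r + 1), by omega⟩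
      have a1 : 2 * (k' * 2 ^ d) ≤ k := by
        apply Nat.le_of_mul_le_mul_right _ hm
        calc _ = _ := by ring
          _ ≤ _ := h1
      have a2 : k + 1 ≤ 2 * ((k' + 1) * 2 ^ d) := by
        apply Nat.le_of_mul_le_mul_right _ hm
        calc _ ≤ _ := h2
          _ = _ := by ring
      have b1 : k' * 2 ^ d ≤ k / 2 := by omega
      have b2 : k / 2 + 1 ≤ (k' + 1) * 2 ^ d := by omega
      constructor
      · calc _ = (k' * 2 ^ d) * 2 ^ (r + 1) := by ring
          _ ≤ _ := Nat.mul_le_mul_right _ b1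
      · calc _ ≤ ((k' + 1) * 2 ^ d) * 2 ^ (r + 1) := Nat.mul_le_mul_right _ b2
          _ = _ := by ring
    · left
      obtain rfl : r = r' := by omega
      have := Nat.le_of_mul_le_mul_right h1 hm
      have := Nat.le_of_mul_le_mul_right h2 hm
      omega
  · rintro (⟨rfl, rfl⟩ | ⟨h1, h2⟩)
    · exact ⟨le_rfl, le_rfl⟩
    · have c1 : (k / 2) * 2 ^ (r + 1) ≤ k * 2 ^ r := by
        calc _ = (2 * (k / 2)) * 2 ^ r := by ring
          _ ≤ _ := Nat.mul_le_mul_right _ (by omega)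
      have c2 : (k + 1) * 2 ^ r ≤ (k / 2 + 1) * 2 ^ (r + 1) := by
        calc _ ≤ (2 * (k / 2 + 1)) * 2 ^ r := Nat.mul_le_mul_right _ (by omega)
          _ = _ := by ring
      exact ⟨h1.trans c1, c2.trans h2⟩

def cov (C : Finset (ℕ × ℕ)) (k r : ℕ) : ℕ :=
  (C.filter fun e => e.1 ≤ k * 2 ^ r ∧ (k + 1) * 2 ^ r ≤ e.2).card

lemma cov_rec {C : Finset (ℕ × ℕ)} (hC : ∀ e ∈ C, LEdge e.1 e.2) (k r : ℕ) :
    cov C k r = (if (k * 2 ^ r, (k + 1) * 2 ^ r) ∈ C then 1 else 0) + cov C (k / 2) (r + 1) := by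
  have h1 : (C.filter fun e => e.1 ≤ k * 2 ^ r ∧ (k + 1) * 2 ^ r ≤ e.2) =
      (C.filter fun e => e = (k * 2 ^ r, (k + 1) * 2 ^ r)) ∪
      (C.filter fun e => e.1 ≤ (k / 2) * 2 ^ (r + 1) ∧ (k / 2 + 1) * 2 ^ (r + 1) ≤ e.2) := by
    ext e
    simp only [Finset.mem_filter, Finset.mem_union, ← and_or_left]
    apply and_congr_right
    intro he
    obtain ⟨k', r', e1, e2⟩ := ledge_iff.1 (hC e he)
    rw [Prod.ext_iff, e1, e2, nest]
    apply or_congr_left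
    constructor
    · rintro ⟨rfl, rfl⟩; simp
    · rintro ⟨h, h'⟩; exact code_inj h h'
  unfold cov
  rw [h1, Finset.card_union_of_disjoint]
  · congr 1
    rw [Finset.filter_eq']
    split_ifs <;> simp
  · rw [Finset.disjoint_left]
    rintro e he1 he2
    simp only [Finset.mem_filter] at he1 he2
    obtain ⟨-, rfl⟩ := he1
    obtain ⟨-, h1, h2⟩ := he2
    simp only at h1 h2
    have hm : 0 < 2 ^ r := by positivity
    have h3 : (2 * (k / 2) + 2) * 2 ^ r ≤ (k + 1) * 2 ^ r := by
      calc _ = _ := by ring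
        _ ≤ _ := h2
    have h4 : k * 2 ^ r ≤ (2 * (k / 2)) * 2 ^ r := by
      calc _ ≤ _ := h1
        _ = _ := by ring
    have := Nat.le_of_mul_le_mul_right h3 hm
    have := Nat.le_of_mul_le_mul_right h4 hm
    omega

lemma cov_zero {C : Finset (ℕ × ℕ)} (hC : ∀ e ∈ C, LEdge e.1 e.2)
    (hcyc : ∀ v : ℕ, Even ((C.filter fun e => e.1 = v ∨ e.2 = v).card)) (k : ℕ) :
    Even (cov C k 0) := by
  have h1 : Even (∑ v ∈ Finset.range (k + 1), (C.filter fun e => e.1 = v ∨ e.2 = v).card) :=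
    Finset.even_sum _ fun v _ => hcyc v
  have h2 : ∑ v ∈ Finset.range (k + 1), (C.filter fun e => e.1 = v ∨ e.2 = v).card =
      ∑ e ∈ C, ((if e.1 ≤ k then 1 else 0) + (if e.2 ≤ k then 1 else 0)) := by
    simp only [Finset.card_filter]
    rw [Finset.sum_comm]
    apply Finset.sum_congr rfl
    intro e he
    have hlt := ledge_lt (hC e he)
    have : ∀ v, (if e.1 = v ∨ e.2 = v then 1 else 0) =
        (if e.1 = v then 1 else 0) + (if e.2 = v then 1 else 0) := by
      intro v
      split_ifs <;> omega
    simp only [this, Finset.sum_add_distrib, Finset.sum_ite_eq, Finset.mem_range, Nat.lt_succ_iff]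
  have h3 : ∑ e ∈ C, ((if e.1 ≤ k then 1 else 0) + (if e.2 ≤ k then 1 else 0)) =
      cov C k 0 + ∑ e ∈ C, 2 * (if e.2 ≤ k then 1 else 0) := by
    unfold cov
    rw [Finset.card_filter, ← Finset.sum_add_distrib]
    apply Finset.sum_congr rfl
    intro e he
    have hlt := ledge_lt (hC e he)
    simp only [pow_zero, mul_one]
    split_ifs <;> omega
  rw [h2, h3, ← Finset.mul_sum] at h1
  exact (Nat.even_add.1 h1).2 (even_two_mul _)

lemma exists_fill {t : ℕ} {C : Finset (ℕ × ℕ)}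
    (hC : ∀ e ∈ C, LEdge e.1 e.2 ∧ e.2 ≤ 2 ^ t)
    (hcyc : ∀ v : ℕ, Even ((C.filter fun e => e.1 = v ∨ e.2 = v).card)) :
    ∃ S : Finset (Finset ℕ), (∀ T ∈ S, IsTriangle t T) ∧ ∀ k r,
      (¬ (tri k r ∈ S ↔ tri (k / 2) (r + 1) ∈ S) ↔ (k * 2 ^ r, (k + 1) * 2 ^ r) ∈ C) := by
  classical
  have hC' := fun e he => (hC e he).1
  let P : Finset (ℕ × ℕ) := ((Finset.range (2 ^ t + 1)) ×ˢ (Finset.range (t + 1))).filter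
    fun p => 1 ≤ p.2 ∧ Odd (cov C p.1 p.2)
  have hcov : ∀ k r, Odd (cov C k r) → 1 ≤ r ∧ (k + 1) * 2 ^ r ≤ 2 ^ t := by
    intro k r h
    constructor
    · by_contra h0
      obtain rfl : r = 0 := by omega
      exact (Nat.not_odd_iff_even.2 (cov_zero hC' hcyc k)) h
    · obtain ⟨e, he⟩ := Finset.card_pos.1 h.pos
      rw [Finset.mem_filter] at he
      exact he.2.2.trans (hC e he.1).2
  have hmem : ∀ k r, tri k r ∈ P.image (fun p => tri p.1 p.2) ↔ Odd (cov C k r) := by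
    have hlt : ∀ k r, Odd (cov C k r) → (k, r) ∈ P := by
      intro k r h
      obtain ⟨h1, h2⟩ := hcov k r h
      have h3 := scale_le h2
      have h4 : k + 1 ≤ (k + 1) * 2 ^ r := Nat.le_mul_of_pos_right _ (by positivity)
      simp only [P, Finset.mem_filter, Finset.mem_product, Finset.mem_range]
      exact ⟨⟨by omega, by omega⟩, h1, h⟩
    intro k r
    constructor
    · intro h
      obtain ⟨⟨k', r'⟩, hp, he⟩ := Finset.mem_image.1 h
      simp only [P, Finset.mem_filter] at hp
      have hb := hcov _ _ hp.2.2
      have ht : IsTriangle t (tri k r) := he ▸ tri_isTriangle hb.1 hb.2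
      obtain ⟨rfl, rfl⟩ := tri_inj hb.1 (tri_bound ht).1 he
      exact hp.2.2
    · intro h
      exact Finset.mem_image.2 ⟨(k, r), hlt k r h, rfl⟩
  refine ⟨P.image (fun p => tri p.1 p.2), ?_, ?_⟩
  · intro T hT
    obtain ⟨⟨k, r⟩, hp, rfl⟩ := Finset.mem_image.1 hT
    simp only [P, Finset.mem_filter] at hp
    have hb := hcov _ _ hp.2.2
    exact tri_isTriangle hb.1 hb.2
  · intro k r
    rw [hmem, hmem, cov_rec hC' k r]
    by_cases h : (k * 2 ^ r, (k + 1) * 2 ^ r) ∈ C <;>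
      simp only [h, if_true, if_false, iff_true, iff_false, Nat.odd_iff] <;> omega

lemma card_bound {t : ℕ} {C : Finset (ℕ × ℕ)} (hne : C.Nonempty)
    (hC : ∀ e ∈ C, LEdge e.1 e.2 ∧ e.2 ≤ 2 ^ t) {S : Finset (Finset ℕ)}
    (hS : ∀ T ∈ S, IsTriangle t T)
    (h : ∀ k r, (¬ (tri k r ∈ S ↔ tri (k / 2) (r + 1) ∈ S) ↔
      (k * 2 ^ r, (k + 1) * 2 ^ r) ∈ C)) : S.card + 2 ≤ C.card := by
  classical
  let Q : Finset (ℕ × ℕ) := ((Finset.range (2 ^ t + 1)) ×ˢ (Finset.range (t + 1))).filter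
    fun p => tri p.1 p.2 ∈ S
  have hQ : ∀ k r, (k, r) ∈ Q ↔ tri k r ∈ S := by
    intro k r
    simp only [Q, Finset.mem_filter, Finset.mem_product, Finset.mem_range]
    refine ⟨fun h => h.2, fun hh => ⟨?_, hh⟩⟩
    obtain ⟨h1, h2⟩ := tri_bound (hS _ hh)
    have h3 := scale_le h2
    have h4 : k + 1 ≤ (k + 1) * 2 ^ r := Nat.le_mul_of_pos_right _ (by positivity)
    omega
  have hQ1 : ∀ k r, (k, r) ∈ Q → 1 ≤ r := fun k r hh => (tri_bound (hS _ ((hQ k r).1 hh))).1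
  have hSQ : S.card = Q.card := by
    symm
    apply Finset.card_bij (fun p _ => tri p.1 p.2)
    · rintro ⟨k, r⟩ hp; exact (hQ k r).1 hp
    · rintro ⟨k, r⟩ hp ⟨k', r'⟩ hp' he
      have := tri_inj (hQ1 _ _ hp) (hQ1 _ _ hp') he
      exact Prod.ext this.1 this.2
    · intro T hT
      obtain ⟨k, r, -, -, rfl⟩ := tri_exists (hS T hT)
      exact ⟨(k, r), (hQ k r).2 hT, rfl⟩
  let f0 : ℕ × ℕ → ℕ × ℕ := fun p => (2 * p.1, p.2 - 1)
  let f1 : ℕ × ℕ → ℕ × ℕ := fun p => (2 * p.1 + 1, p.2 - 1)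
  let D := Q.image f0 ∪ Q.image f1
  have hD : ∀ k r, (k, r) ∈ D ↔ (k / 2, r + 1) ∈ Q := by
    intro k r
    simp only [D, f0, f1, Finset.mem_union, Finset.mem_image, Prod.exists, Prod.mk.injEq]
    constructor
    · rintro (⟨a, b, hab, rfl, rfl⟩ | ⟨a, b, hab, rfl, rfl⟩)
      · have := hQ1 _ _ hab
        rwa [show 2 * a / 2 = a by omega, show b - 1 + 1 = b by omega]
      · have := hQ1 _ _ hab
        rwa [show (2 * a + 1) / 2 = a by omega, show b - 1 + 1 = b by omega]
    · intro hh
      rcases Nat.even_or_odd' k with ⟨j, hj⟩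
      rcases hj with hj | hj
      · exact Or.inl ⟨_, _, hh, by omega, by omega⟩
      · exact Or.inr ⟨_, _, hh, by omega, by omega⟩
  have hDcard : D.card = 2 * Q.card := by
    have hd : Disjoint (Q.image f0) (Q.image f1) := by
      rw [Finset.disjoint_left]
      intro p h1 h2
      obtain ⟨a, -, rfl⟩ := Finset.mem_image.1 h1
      obtain ⟨b, -, hb⟩ := Finset.mem_image.1 h2
      simp only [f0, f1, Prod.mk.injEq] at hb
      omega
    rw [Finset.card_union_of_disjoint hd, Finset.card_image_of_injOn, Finset.card_image_of_injOn]
    · omega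
    · rintro ⟨a, b⟩ h1 ⟨a', b'⟩ h2 he
      have := hQ1 _ _ h1; have := hQ1 _ _ h2
      simp only [f1, Prod.mk.injEq] at he ⊢
      omega
    · rintro ⟨a, b⟩ h1 ⟨a', b'⟩ h2 he
      have := hQ1 _ _ h1; have := hQ1 _ _ h2
      simp only [f0, Prod.mk.injEq] at he ⊢
      omega
  have hQne : Q.Nonempty := by
    obtain ⟨⟨x, y⟩, he⟩ := hne
    obtain ⟨k, r, e1, e2⟩ := ledge_iff.1 (hC _ he).1
    simp only at e1 e2
    subst e1 e2
    have := (h k r).2 he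
    rw [← hQ, ← hQ] at this
    by_contra hemp
    rw [Finset.not_nonempty_iff_eq_empty] at hemp
    simp [hemp] at this
  have hint : (Q ∩ D).card < Q.card := by
    obtain ⟨p, hp, hmax⟩ := Finset.exists_max_image Q (fun p => p.2) hQne
    apply Finset.card_lt_card
    rw [Finset.ssubset_iff_of_subset Finset.inter_subset_left]
    refine ⟨p, hp, fun hh => ?_⟩
    have h1 := (hD p.1 p.2).1 (Finset.mem_inter.1 hh).2
    have := hmax _ h1
    simp at this
  have hle : ((Q \ D) ∪ (D \ Q)).card ≤ C.card := by
    apply Finset.card_le_card_of_injOn (fun p => (p.1 * 2 ^ p.2, (p.1 + 1) * 2 ^ p.2))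
    · rintro ⟨k, r⟩ hp
      apply (h k r).1
      rw [← hQ, ← hQ, ← hD]
      simp only [Finset.coe_union, Finset.coe_sdiff, Set.mem_union, Set.mem_sdiff,
        Finset.mem_coe] at hp
      tauto
    · rintro ⟨k, r⟩ _ ⟨k', r'⟩ _ he
      simp only [Prod.mk.injEq] at he
      have := code_inj he.1 he.2
      simp [this.1, this.2]
  have hdd : Disjoint (Q \ D) (D \ Q) := disjoint_sdiff_sdiff
  rw [Finset.card_union_of_disjoint hdd] at hle
  have c1 := Finset.card_sdiff_add_card_inter Q D
  have c2 := Finset.card_sdiff_add_card_inter D Q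
  rw [Finset.inter_comm] at c2
  omega

lemma fill_sub {t : ℕ} {C : Finset (ℕ × ℕ)} {S S' : Finset (Finset ℕ)}
    (hS : ∀ T ∈ S, IsTriangle t T) (hS' : ∀ T ∈ S', IsTriangle t T)
    (h : ∀ k r, (k + 1) * 2 ^ r ≤ 2 ^ t → (¬ (tri k r ∈ S ↔ tri (k / 2) (r + 1) ∈ S) ↔
      (k * 2 ^ r, (k + 1) * 2 ^ r) ∈ C))
    (h' : ∀ k r, (k + 1) * 2 ^ r ≤ 2 ^ t → (¬ (tri k r ∈ S' ↔ tri (k / 2) (r + 1) ∈ S') ↔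
      (k * 2 ^ r, (k + 1) * 2 ^ r) ∈ C)) : S' = S := by
  have key : ∀ d k r, t < r + d → (tri k r ∈ S' ↔ tri k r ∈ S) := by
    intro d
    induction d with
    | zero =>
      intro k r hr
      have h1 : ∀ S : Finset (Finset ℕ), (∀ T ∈ S, IsTriangle t T) → tri k r ∉ S := by
        intro S hS hh
        have := scale_le (tri_bound (hS _ hh)).2
        omega
      simp [h1 S hS, h1 S' hS']
    | succ d ih =>
      intro k r hr
      by_cases hb : (k + 1) * 2 ^ r ≤ 2 ^ t
      · have i := ih (k / 2) (r + 1) (by omega)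
        have a := h k r hb
        have b := h' k r hb
        tauto
      · have h1 : ∀ S : Finset (Finset ℕ), (∀ T ∈ S, IsTriangle t T) → tri k r ∉ S :=
          fun S hS hh => hb (tri_bound (hS _ hh)).2
        simp [h1 S hS, h1 S' hS']
  ext T
  constructor
  · intro hT
    obtain ⟨k, r, -, -, rfl⟩ := tri_exists (hS' T hT)
    exact (key (t + 1) k r (by omega)).1 hT
  · intro hT
    obtain ⟨k, r, -, -, rfl⟩ := tri_exists (hS T hT)
    exact (key (t + 1) k r (by omega)).2 hT

/-- Let `C` be a nonempty finite set of edges of the log-path graph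
`L_t` (edges recorded as pairs `(x, y)` with `x < y`) such that every vertex is incident
to an even number of edges of `C` (an `𝔽₂` 1-cycle).  Then there is a unique finite set
`S` of triangles of `L_t` whose `𝔽₂`-boundary equals `C` (an edge of `L_t` lies in an odd
number of triangles of `S` iff it belongs to `C`), and this `S` satisfies
`|S| ≤ |C| − 2`. -/
theorem logpath_unique_triangle_filling (t : ℕ) (C : Finset (ℕ × ℕ)) (hne : C.Nonempty)
    (hC : ∀ e ∈ C, LEdge e.1 e.2 ∧ e.2 ≤ 2 ^ t)
    (hcyc : ∀ v : ℕ, Even ((C.filter fun e => e.1 = v ∨ e.2 = v).card)) :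
    ∃ S : Finset (Finset ℕ),
      ((∀ T ∈ S, IsTriangle t T) ∧
        ∀ x y : ℕ, LEdge x y → y ≤ 2 ^ t →
          (Odd ((S.filter fun T => x ∈ T ∧ y ∈ T).card) ↔ (x, y) ∈ C)) ∧
      S.card ≤ C.card - 2 ∧
      ∀ S' : Finset (Finset ℕ),
        ((∀ T ∈ S', IsTriangle t T) ∧
          ∀ x y : ℕ, LEdge x y → y ≤ 2 ^ t →
            (Odd ((S'.filter fun T => x ∈ T ∧ y ∈ T).card) ↔ (x, y) ∈ C)) →
        S' = S := by
  obtain ⟨S, hS, h⟩ := exists_fill hC hcyc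
  refine ⟨S, ⟨hS, ?_⟩, ?_, ?_⟩
  · intro x y hxy _
    obtain ⟨k, r, rfl, rfl⟩ := ledge_iff.1 hxy
    rw [odd_iff hS, h]
  · have := card_bound hne hC hS h
    omega
  · rintro S' ⟨hS', h'⟩
    refine fill_sub hS hS' (fun k r _ => h k r) (fun k r hb => ?_)
    rw [← odd_iff hS', h' _ _ (ledge_mk k r) hb]
end
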